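/- arXiv:1807.05376 — 2 statements merged into one kernel-verified Lean document; each statement's English description precedes it below -/
import Mathlib

section
/- A 2-coloured graph (G,c) is generically isostatic in the plane if and only if (1) G is a Laman+2 graph, (2) no colour class E_i (i ∈ {1,2}) consists only of bridges of M_2(G), and (3) G_0 is Laman-sparse and both G_1 and G_2 are (2,2)-sparse. -/
open scoped RealInnerProductSpace

namespace CoordRigidity

variable {V : Type*} [Fintype V] [DecidableEq V] {d k : ℕ}

abbrev Cfg (V : Type*) (d : ℕ) := V → EuclideanSpace ℝ (Fin d)

/-- `p` is generic: its `d|V|` coordinates are algebraically independent over `ℚ`. -/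
def Generic (p : Cfg V d) : Prop :=
  AlgebraicIndependent ℚ (fun vi : V × Fin d => p vi.1 vi.2)

def FrameworkEquiv (G : SimpleGraph V) (p q : Cfg V d) : Prop :=
  ∀ i j, G.Adj i j → dist (p i) (p j) = dist (q i) (q j)

def Congruent (p q : Cfg V d) : Prop :=
  ∃ T : EuclideanSpace ℝ (Fin d) ≃ᵢ EuclideanSpace ℝ (Fin d), ∀ v, q v = T (p v)

def Rigid (G : SimpleGraph V) (p : Cfg V d) : Prop :=
  ∃ U ∈ nhds p, ∀ q ∈ U, FrameworkEquiv G p q → Congruent p q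

def IsInfMotion (G : SimpleGraph V) (p p' : Cfg V d) : Prop :=
  ∀ i j, G.Adj i j → ⟪p j - p i, p' j - p' i⟫ = 0

def IsTrivialMotion (p p' : Cfg V d) : Prop :=
  ∃ (S : Matrix (Fin d) (Fin d) ℝ) (t : Fin d → ℝ),
    S.transpose = -S ∧ ∀ v i, p' v i = (∑ j, S i j * p v j) + t i

def InfRigid (G : SimpleGraph V) (p : Cfg V d) : Prop :=
  ∀ p', IsInfMotion G p p' → IsTrivialMotion p p'

def FiniteMotion (G : SimpleGraph V) (p : Cfg V d) (P : ℝ → Cfg V d) : Prop :=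
  ContinuousOn P (Set.Ico 0 1) ∧ P 0 = p ∧
    ∀ t ∈ Set.Ico (0:ℝ) 1, FrameworkEquiv G p (P t)

def Flexible (G : SimpleGraph V) (p : Cfg V d) : Prop :=
  ∃ P, FiniteMotion G p P ∧ ∃ t ∈ Set.Ico (0:ℝ) 1, ¬ Congruent p (P t)

def IsEquilibriumLoad (p f : Cfg V d) : Prop :=
  (∑ i, f i) = 0 ∧
  ∀ j k : Fin d, j < k → (∑ i, (f i j * p i k - f i k * p i j)) = 0

def Resolves (G : SimpleGraph V) [DecidableRel G.Adj] (p : Cfg V d)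
    (ρ : Sym2 V → ℝ) (f : Cfg V d) : Prop :=
  ∀ i, (∑ j, if G.Adj i j then ρ s(i,j) • (p j - p i) else 0) = -f i

def IsEquilibriumStress (G : SimpleGraph V) [DecidableRel G.Adj] (p : Cfg V d)
    (ω : Sym2 V → ℝ) : Prop :=
  ∀ i, (∑ j, if G.Adj i j then ω s(i,j) • (p j - p i) else 0) = (0 : EuclideanSpace ℝ (Fin d))

/-- The row of the rigidity matrix corresponding to an edge. -/
noncomputable def rRow (p : Cfg V d) : Sym2 V → (V × Fin d → ℝ) :=
  Sym2.lift ⟨fun i j vk =>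
      (if vk.1 = i then p i vk.2 - p j vk.2 else 0) +
      (if vk.1 = j then p j vk.2 - p i vk.2 else 0),
    fun _ _ => funext fun _ => add_comm _ _⟩

noncomputable def coordRow (c : Sym2 V → Option (Fin k)) (p : Cfg V d) (e : Sym2 V) :
    (V × Fin d) ⊕ Fin k → ℝ :=
  Sum.elim (rRow p e) (fun ℓ => if c e = some ℓ then 1 else 0)

noncomputable def rowRank (p : Cfg V d) (F : Set (Sym2 V)) : ℕ :=
  Module.finrank ℝ ↥(Submodule.span ℝ (rRow p '' F))

def CoordEquiv (G : SimpleGraph V) (c : Sym2 V → Option (Fin k))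
    (p : Cfg V d) (r : Fin k → ℝ) (q : Cfg V d) (s : Fin k → ℝ) : Prop :=
  (∀ i j, G.Adj i j → c s(i,j) = none → dist (p i) (p j) = dist (q i) (q j)) ∧
  (∀ i j ℓ, G.Adj i j → c s(i,j) = some ℓ →
    dist (p i) (p j) + r ℓ = dist (q i) (q j) + s ℓ)

def CoordCongruent (G : SimpleGraph V) (c : Sym2 V → Option (Fin k))
    (p : Cfg V d) (r : Fin k → ℝ) (q : Cfg V d) (s : Fin k → ℝ) : Prop :=
  CoordEquiv G c p r q s ∧ Congruent p q

def CoordRigid (G : SimpleGraph V) (c : Sym2 V → Option (Fin k))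
    (p : Cfg V d) (r : Fin k → ℝ) : Prop :=
  ∃ U ∈ nhds (p, r), ∀ qs : Cfg V d × (Fin k → ℝ), qs ∈ U →
    CoordEquiv G c p r qs.1 qs.2 → CoordCongruent G c p r qs.1 qs.2

def IsCoordInfMotion (G : SimpleGraph V) (c : Sym2 V → Option (Fin k))
    (p : Cfg V d) (p' : Cfg V d) (r' : Fin k → ℝ) : Prop :=
  (∀ i j, G.Adj i j → c s(i,j) = none → ⟪p j - p i, p' j - p' i⟫ = 0) ∧
  (∀ i j ℓ, G.Adj i j → c s(i,j) = some ℓ → ⟪p j - p i, p' j - p' i⟫ + r' ℓ = 0)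

def CoordInfRigid (G : SimpleGraph V) (c : Sym2 V → Option (Fin k)) (p : Cfg V d) : Prop :=
  ∀ p' r', IsCoordInfMotion G c p p' r' → r' = 0 ∧ IsTrivialMotion p p'

def CoordFiniteMotion (G : SimpleGraph V) (c : Sym2 V → Option (Fin k))
    (p : Cfg V d) (r : Fin k → ℝ) (P : ℝ → Cfg V d) (R : ℝ → (Fin k → ℝ)) : Prop :=
  ContinuousOn (fun t => (P t, R t)) (Set.Ico 0 1) ∧ P 0 = p ∧ R 0 = r ∧
    ∀ t ∈ Set.Ico (0:ℝ) 1, CoordEquiv G c p r (P t) (R t)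

def CoordFlexible (G : SimpleGraph V) (c : Sym2 V → Option (Fin k))
    (p : Cfg V d) (r : Fin k → ℝ) : Prop :=
  ∃ P R, CoordFiniteMotion G c p r P R ∧
    ∃ t ∈ Set.Ico (0:ℝ) 1, ¬ CoordCongruent G c p r (P t) (R t)

/-- Combinatorial Laman-type notions, for a "subgraph" given by a vertex set `W`
and an edge set `E'`. -/
def support (E' : Set (Sym2 V)) : Set V := {v | ∃ e ∈ E', v ∈ e}

def edgesWithin (E' : Set (Sym2 V)) (W : Set V) : Set (Sym2 V) :=
  {e ∈ E' | ∀ v ∈ e, v ∈ W}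

def LamanSparseOn (W : Set V) (E' : Set (Sym2 V)) : Prop :=
  ∀ W' ⊆ W, 2 ≤ W'.ncard → (edgesWithin E' W').ncard ≤ 2 * W'.ncard - 3

def Sparse22On (W : Set V) (E' : Set (Sym2 V)) : Prop :=
  ∀ W' ⊆ W, 2 ≤ W'.ncard → (edgesWithin E' W').ncard ≤ 2 * W'.ncard - 2

def IsLamanOn (W : Set V) (E' : Set (Sym2 V)) : Prop :=
  LamanSparseOn W E' ∧ E'.ncard = 2 * W.ncard - 3

def IsLamanCircuitOn (W : Set V) (E' : Set (Sym2 V)) : Prop :=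
  E'.ncard = 2 * W.ncard - 2 ∧ ∀ e ∈ E', IsLamanOn W (E' \ {e})

def IsLamanPlusOne (G : SimpleGraph V) : Prop :=
  G.edgeSet.ncard = 2 * Fintype.card V - 2 ∧
    ∃ e ∈ G.edgeSet, IsLamanOn Set.univ (G.edgeSet \ {e})

def IsLamanPlusTwo (G : SimpleGraph V) : Prop :=
  G.edgeSet.ncard = 2 * Fintype.card V - 1 ∧
    ∃ e ∈ G.edgeSet, ∃ f ∈ G.edgeSet, e ≠ f ∧
      IsLamanOn Set.univ (G.edgeSet \ {e, f})

/-- An edge is redundant in the generic `d`-dimensional rigidity matroid of `G`. -/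
def RedundantSet (d : ℕ) (G : SimpleGraph V) (F : Set (Sym2 V)) : Prop :=
  ∀ p : Cfg V d, Generic p → rowRank p (G.edgeSet \ F) = rowRank p G.edgeSet

/-- `(G,c)` is generically independent in dimension `d`: for generic `p` the rows of the
coordinated rigidity matrix `R⁺(p)` are linearly independent. -/
def GenericallyIndependentCoord {V : Type*} [Fintype V] [DecidableEq V] {k : ℕ} (d : ℕ)
    (G : SimpleGraph V) (c : Sym2 V → Option (Fin k)) : Prop :=
  ∀ p : Cfg V d, Generic p →
    LinearIndependent ℝ (fun e : G.edgeSet => coordRow c p ↑e)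

/-- `(G,c)` is generically isostatic in dimension `d`: for generic `p` the rows of
`R⁺(p)` are linearly independent and the coordinated framework is infinitesimally
rigid. -/
def GenericallyIsostaticCoord {V : Type*} [Fintype V] [DecidableEq V] {k : ℕ} (d : ℕ)
    (G : SimpleGraph V) (c : Sym2 V → Option (Fin k)) : Prop :=
  ∀ p : Cfg V d, Generic p →
    LinearIndependent ℝ (fun e : G.edgeSet => coordRow c p ↑e) ∧ CoordInfRigid G c p

set_option linter.unusedSectionVars false

/-! ### Generic configurations -/

theorem exists_generic (V : Type*) [Finite V] (d : ℕ) : ∃ p : Cfg V d, Generic p := by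
  obtain ⟨s, hs⟩ := exists_isTranscendenceBasis ℚ ℝ
  have hinf : s.Infinite := by
    by_contra hfin
    have hcount : Cardinal.mk s ≤ Cardinal.aleph0 :=
      Cardinal.mk_le_aleph0_iff.2 (Set.not_infinite.1 hfin).countable
    have hle : Cardinal.mk ℝ ≤ Cardinal.aleph0 := by
      rcases isEmpty_or_nonempty s with hempty | hne
      · have : Algebra.IsAlgebraic ℚ ℝ := hs.isEmpty_iff_isAlgebraic.1 hempty
        simpa using Algebra.IsAlgebraic.cardinalMk_le_max ℚ ℝ
      · have := hs.lift_cardinalMk_eq_max_lift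
        simp only [Cardinal.lift_id] at this
        rw [this]
        simpa using hcount
    exact absurd hle (by simpa [Cardinal.mk_real] using Cardinal.aleph0_lt_continuum)
  have := hinf.to_subtype
  let g : V × Fin d ↪ s :=
    ((Finite.equivFin (V × Fin d)).toEmbedding.trans Fin.valEmbedding).trans
      (Infinite.natEmbedding s)
  refine ⟨fun v => WithLp.toLp 2 fun i => (g (v, i) : ℝ), ?_⟩
  exact hs.1.comp g g.injective

theorem Generic.aeval_ne_zero {p₀ : Cfg V d} (hp₀ : Generic p₀) {f : MvPolynomial (V × Fin d) ℚ}
    {p : Cfg V d} (h : MvPolynomial.aeval (fun vi : V × Fin d => p vi.1 vi.2) f ≠ 0) :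
    MvPolynomial.aeval (fun vi : V × Fin d => p₀ vi.1 vi.2) f ≠ 0 := by
  have h0 : f ≠ 0 := by rintro rfl; simp at h
  intro h1
  exact h0 ((injective_iff_map_eq_zero _).1 hp₀ f h1)

/-- The signed area of the triangle spanned by `p a`, `p b`, `p c` (up to a factor of two). -/
def area (p : Cfg V 2) (a b c : V) : ℝ :=
  (p b 0 - p a 0) * (p c 1 - p a 1) - (p b 1 - p a 1) * (p c 0 - p a 0)

theorem Generic.area_ne_zero {p : Cfg V 2} (hp : Generic p) {a b c : V}
    (hab : a ≠ b) (hac : a ≠ c) (hbc : b ≠ c) : area p a b c ≠ 0 := by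
  let f : MvPolynomial (V × Fin 2) ℚ :=
    (.X (b, 0) - .X (a, 0)) * (.X (c, 1) - .X (a, 1)) -
      (.X (b, 1) - .X (a, 1)) * (.X (c, 0) - .X (a, 0))
  have key : ∀ q : Cfg V 2,
      MvPolynomial.aeval (fun vi : V × Fin 2 => q vi.1 vi.2) f = area q a b c := by
    intro q; simp [f, area]
  rw [← key]
  let q : Cfg V 2 := fun v => if v = b then !₂[1, 0] else if v = c then !₂[0, 1] else 0
  apply hp.aeval_ne_zero (p := q)
  rw [key]
  simp [area, q, hab, hac, hbc.symm]

theorem Generic.sub_ne_zero {p : Cfg V 2} (hp : Generic p) {a b : V} (hab : a ≠ b) :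
    p a 0 - p b 0 ≠ 0 := by
  let f : MvPolynomial (V × Fin 2) ℚ := .X (a, 0) - .X (b, 0)
  have key : ∀ q : Cfg V 2,
      MvPolynomial.aeval (fun vi : V × Fin 2 => q vi.1 vi.2) f = q a 0 - q b 0 := by
    intro q; simp [f]
  rw [← key]
  let q : Cfg V 2 := fun v => if v = a then !₂[1, 0] else 0
  apply hp.aeval_ne_zero (p := q)
  rw [key]
  simp [q, hab.symm]

/-! ### Weighted rows -/

theorem rRow_mk (p : Cfg V d) (a b v : V) (i : Fin d) :
    rRow p s(a, b) (v, i) =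
      (if v = a then p a i - p b i else 0) + (if v = b then p b i - p a i else 0) := rfl

theorem rRow_diag (p : Cfg V d) (e : Sym2 V) (he : e.IsDiag) : rRow p e = 0 := by
  induction e with | h a b =>
  obtain rfl : a = b := by simpa using he
  ext ⟨v, i⟩
  simp [rRow_mk]

theorem rRow_apply_of_notMem (p : Cfg V d) {e : Sym2 V} {v : V} (hv : v ∉ e) (i : Fin d) :
    rRow p e (v, i) = 0 := by
  induction e with | h a b =>
  simp only [Sym2.mem_iff, not_or] at hv
  simp [rRow_mk, hv.1, hv.2]

/-- The weight part of the row of a pair `t` consisting of an edge and a rational weight vector. -/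
def weight (t : Sym2 V × (Fin k → ℚ)) : Fin k → ℝ := fun ℓ => (t.2 ℓ : ℝ)

/-- The row of the weighted rigidity matrix: the rigidity row of the edge `t.1`, followed by the
weight `t.2`. A diagonal `t.1` contributes a pure weight row. -/
noncomputable def wRow (p : Cfg V d) (t : Sym2 V × (Fin k → ℚ)) : (V × Fin d) ⊕ Fin k → ℝ :=
  Sum.elim (rRow p t.1) (weight t)

@[simp] theorem wRow_inl (p : Cfg V d) (t : Sym2 V × (Fin k → ℚ)) (x : V × Fin d) :
    wRow p t (.inl x) = rRow p t.1 x := rfl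

@[simp] theorem wRow_inr (p : Cfg V d) (t : Sym2 V × (Fin k → ℚ)) (ℓ : Fin k) :
    wRow p t (.inr ℓ) = t.2 ℓ := rfl

theorem exists_poly_wRow (t : Sym2 V × (Fin k → ℚ)) (x : (V × Fin d) ⊕ Fin k) :
    ∃ f : MvPolynomial (V × Fin d) ℚ, ∀ p : Cfg V d,
      MvPolynomial.aeval (fun vi : V × Fin d => p vi.1 vi.2) f = wRow p t x := by
  obtain ⟨e, w⟩ := t
  induction e with | h a b =>
  rcases x with ⟨v, i⟩ | ℓ
  · refine ⟨(if v = a then .X (a, i) - .X (b, i) else 0) +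
      (if v = b then .X (b, i) - .X (a, i) else 0), fun p => ?_⟩
    rw [wRow_inl, rRow_mk]
    split_ifs <;> simp
  · exact ⟨.C (w ℓ), fun p => by simp⟩

theorem linearIndependent_row_iff_det_ne_zero {ι κ : Type*} [Fintype ι] [DecidableEq ι] [Fintype κ]
    (A : Matrix ι κ ℝ) : LinearIndependent ℝ A.row ↔ (A * A.transpose).det ≠ 0 := by
  rw [← isUnit_iff_ne_zero, ← Matrix.isUnit_iff_isUnit_det, ← Matrix.vecMul_injective_iff_isUnit,
    ← Matrix.vecMul_injective_iff]
  have h1 : Function.Injective A.vecMul ↔ ∀ v, Matrix.vecMul v A = 0 → v = 0 :=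
    injective_iff_map_eq_zero A.vecMulLinear
  have h2 : Function.Injective (A * A.transpose).vecMul ↔
      ∀ v, Matrix.vecMul v (A * A.transpose) = 0 → v = 0 :=
    injective_iff_map_eq_zero (A * A.transpose).vecMulLinear
  rw [h1, h2]
  refine forall_congr' fun v => ?_
  have := Matrix.vecMul_self_mul_conjTranspose_eq_zero A v
  rw [Matrix.conjTranspose_eq_transpose_of_trivial] at this
  rw [this]

/-- Independence of weighted rows at some configuration implies independence at every generic
configuration. -/
theorem Generic.linearIndepOn_wRow {p₀ : Cfg V d} (hp₀ : Generic p₀) {p : Cfg V d}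
    {S : Set (Sym2 V × (Fin k → ℚ))} (hS : S.Finite) (h : LinearIndepOn ℝ (wRow p) S) :
    LinearIndepOn ℝ (wRow p₀) S := by
  classical
  have := hS.fintype
  choose f hf using fun (t : S) (x : (V × Fin d) ⊕ Fin k) => exists_poly_wRow (d := d) t.1 x
  let A : Matrix S ((V × Fin d) ⊕ Fin k) (MvPolynomial (V × Fin d) ℚ) := f
  have hA : ∀ q : Cfg V d, LinearIndepOn ℝ (wRow q) S ↔
      MvPolynomial.aeval (fun vi : V × Fin d => q vi.1 vi.2) (A * A.transpose).det ≠ 0 := by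
    intro q
    rw [AlgHom.map_det, AlgHom.mapMatrix_apply, Matrix.map_mul, Matrix.transpose_map,
      ← linearIndependent_row_iff_det_ne_zero]
    have : (A.map (MvPolynomial.aeval (fun vi : V × Fin d => q vi.1 vi.2))).row =
        fun t : S => wRow q t.1 := by
      ext t x
      exact hf t x q
    rw [this]
    rfl
  rw [hA] at h ⊢
  exact hp₀.aeval_ne_zero h

/-! ### Adding a vertex of degree at most three -/

/-- Every non-diagonal edge occurring in `H` avoids the vertex `v`. -/
def Avoids (H : Set (Sym2 V × (Fin 2 → ℚ))) (v : V) : Prop :=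
  ∀ t ∈ H, ¬ t.1.IsDiag → v ∉ t.1

theorem Avoids.rRow_apply {H : Set (Sym2 V × (Fin 2 → ℚ))} {v : V} (hH : Avoids H v)
    (p : Cfg V 2) {t : Sym2 V × (Fin 2 → ℚ)} (ht : t ∈ H) (i : Fin 2) :
    rRow p t.1 (v, i) = 0 := by
  by_cases hd : t.1.IsDiag
  · rw [rRow_diag p _ hd]; rfl
  · exact rRow_apply_of_notMem p (hH t ht hd) i

theorem Avoids.span_apply {H : Set (Sym2 V × (Fin 2 → ℚ))} {v : V} {p : Cfg V 2}
    (hH : ∀ t ∈ H, ∀ i, rRow p t.1 (v, i) = 0) {h : (V × Fin 2) ⊕ Fin 2 → ℝ}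
    (hh : h ∈ Submodule.span ℝ (wRow p '' H)) (i : Fin 2) : h (.inl (v, i)) = 0 := by
  induction hh using Submodule.span_induction with
  | mem x hx =>
    obtain ⟨t, ht, rfl⟩ := hx
    exact hH t ht i
  | zero => rfl
  | add x y _ _ hx hy => simp [hx, hy]
  | smul a x _ hx => simp [hx]

theorem rRow_update (p : Cfg V 2) {e : Sym2 V} {v : V} (h : ¬ e.IsDiag → v ∉ e)
    (q : EuclideanSpace ℝ (Fin 2)) : rRow (Function.update p v q) e = rRow p e := by
  by_cases hd : e.IsDiag
  · rw [rRow_diag _ _ hd, rRow_diag _ _ hd]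
  have hv := h hd
  induction e with | h a b =>
  simp only [Sym2.mem_iff, not_or] at hv
  ext ⟨x, i⟩
  simp [rRow_mk, Function.update_of_ne (Ne.symm hv.1), Function.update_of_ne (Ne.symm hv.2)]

theorem wRow_update (p : Cfg V 2) {t : Sym2 V × (Fin 2 → ℚ)} {v : V} (h : ¬ t.1.IsDiag → v ∉ t.1)
    (q : EuclideanSpace ℝ (Fin 2)) : wRow (Function.update p v q) t = wRow p t := by
  rw [wRow, wRow, rRow_update p h]

theorem Avoids.image_update {H : Set (Sym2 V × (Fin 2 → ℚ))} {v : V} (hH : Avoids H v)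
    (p : Cfg V 2) (q : EuclideanSpace ℝ (Fin 2)) :
    wRow (Function.update p v q) '' H = wRow p '' H :=
  Set.image_congr fun t ht => wRow_update p (hH t ht) q

theorem Avoids.linearIndepOn_update {H : Set (Sym2 V × (Fin 2 → ℚ))} {v : V} (hH : Avoids H v)
    {p : Cfg V 2} (q : EuclideanSpace ℝ (Fin 2)) (h : LinearIndepOn ℝ (wRow p) H) :
    LinearIndepOn ℝ (wRow (Function.update p v q)) H :=
  h.congr fun t ht => (wRow_update p (hH t ht) q).symm

theorem rRow_self (p : Cfg V 2) {v a : V} (h : v ≠ a) (i : Fin 2) :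
    rRow p s(v, a) (v, i) = p v i - p a i := by
  simp [rRow_mk, h]

theorem notMem_span_of_ne {H : Set (Sym2 V × (Fin 2 → ℚ))} {v a : V} {p : Cfg V 2}
    (hH : ∀ t ∈ H, ∀ i, rRow p t.1 (v, i) = 0) (hva : v ≠ a) {i : Fin 2} (hp : p v i ≠ p a i)
    (w : Fin 2 → ℚ) : wRow p (s(v, a), w) ∉ Submodule.span ℝ (wRow p '' H) := by
  intro h
  have := Avoids.span_apply hH h i
  rw [wRow_inl, rRow_self p hva] at this
  exact hp (sub_eq_zero.1 this)

theorem notMem_span_insert {H : Set (Sym2 V × (Fin 2 → ℚ))} {v a b : V} {p : Cfg V 2}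
    (hH : ∀ t ∈ H, ∀ i, rRow p t.1 (v, i) = 0) (hva : v ≠ a) (hvb : v ≠ b)
    (hp : area p v a b ≠ 0) (w w' : Fin 2 → ℚ) :
    wRow p (s(v, a), w) ∉ Submodule.span ℝ (wRow p '' insert (s(v, b), w') H) := by
  intro h
  rw [Set.image_insert_eq, Submodule.mem_span_insert] at h
  obtain ⟨α, h, hh, he⟩ := h
  have key : ∀ i, p v i - p a i = α * (p v i - p b i) := by
    intro i
    have := congrFun he (.inl (v, i))
    rw [Pi.add_apply, Avoids.span_apply hH hh, Pi.smul_apply, wRow_inl, wRow_inl, rRow_self p hva,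
      rRow_self p hvb] at this
    simpa using this
  apply hp
  have h0 := key 0
  have h1 := key 1
  rw [area]
  linear_combination (p v 1 - p b 1) * h0 - (p v 0 - p b 0) * h1

theorem linearIndepOn_insert_two {H : Set (Sym2 V × (Fin 2 → ℚ))} {v a b : V} {p : Cfg V 2}
    (hH : ∀ t ∈ H, ∀ i, rRow p t.1 (v, i) = 0) (hva : v ≠ a) (hvb : v ≠ b)
    (hp : area p v a b ≠ 0) (w w' : Fin 2 → ℚ) (h : LinearIndepOn ℝ (wRow p) H) :
    LinearIndepOn ℝ (wRow p) (insert (s(v, a), w) (insert (s(v, b), w') H)) := by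
  obtain ⟨i, hi⟩ : ∃ i, p v i ≠ p b i := by
    by_contra! hcon
    exact hp (by rw [area, hcon 0, hcon 1]; ring)
  exact (h.insert (notMem_span_of_ne hH hvb hi w')).insert
    (notMem_span_insert hH hva hvb hp w w')

/-- Place the new vertex `v` on top of its neighbour `a`. -/
theorem exists_linearIndepOn_of_weight {H : Set (Sym2 V × (Fin 2 → ℚ))} {v a b c : V} {p : Cfg V 2}
    (hH : Avoids H v) (hva : v ≠ a) (hvb : v ≠ b) (hvc : v ≠ c) (hp : area p a b c ≠ 0)
    (wa wb wc : Fin 2 → ℚ) (h : LinearIndepOn ℝ (wRow p) H) {z : V}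
    (hw : wRow p (s(z, z), wa) ∉ Submodule.span ℝ (wRow p '' H)) :
    ∃ q, LinearIndepOn ℝ (wRow (Function.update p v q))
      (insert (s(v, b), wb) (insert (s(v, c), wc) (insert (s(v, a), wa) H))) := by
  refine ⟨p a, ?_⟩
  set p' := Function.update p v (p a) with hp'
  have hv : p' v = p a := Function.update_self ..
  have ha : p' a = p a := Function.update_of_ne hva.symm ..
  have hb : p' b = p b := Function.update_of_ne hvb.symm ..
  have hc : p' c = p c := Function.update_of_ne hvc.symm ..
  have hrow : wRow p' (s(v, a), wa) = wRow p (s(z, z), wa) := by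
    ext x
    rcases x with ⟨x, i⟩ | ℓ
    · simp [rRow_mk, hv, ha]
    · rfl
  refine linearIndepOn_insert_two ?_ hvb hvc ?_ wb wc
    ((hH.linearIndepOn_update (p a) h).insert ?_)
  · rintro t (rfl | ht) i
    · rw [rRow_self p' hva, hv, ha, sub_self]
    · exact hH.rRow_apply p' ht i
  · simpa [area, hv, hb, hc] using hp
  · rw [hrow, hH.image_update]
    exact hw

/-- Place the new vertex `v` at the midpoint of its neighbours `a` and `b`. -/
theorem exists_linearIndepOn_of_edge {H : Set (Sym2 V × (Fin 2 → ℚ))} {v a b c : V} {p : Cfg V 2}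
    (hH : Avoids H v) (hva : v ≠ a) (hvb : v ≠ b) (hvc : v ≠ c) (hp : area p a b c ≠ 0)
    (wa wb wc : Fin 2 → ℚ) (h : LinearIndepOn ℝ (wRow p) H) {z : V}
    (hwa : wRow p (s(z, z), wa) ∈ Submodule.span ℝ (wRow p '' H))
    (hwb : wRow p (s(z, z), wb) ∈ Submodule.span ℝ (wRow p '' H))
    (hab : wRow p (s(a, b), 0) ∉ Submodule.span ℝ (wRow p '' H)) :
    ∃ q, LinearIndepOn ℝ (wRow (Function.update p v q))
      (insert (s(v, b), wb) (insert (s(v, a), wa) (insert (s(v, c), wc) H))) := by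
  let m : EuclideanSpace ℝ (Fin 2) := (1 / 2 : ℝ) • (p a + p b)
  have hm : ∀ i, m i = (p a i + p b i) / 2 := by
    intro i
    simp only [m, PiLp.smul_apply, PiLp.add_apply, smul_eq_mul]
    ring
  refine ⟨m, ?_⟩
  set p' := Function.update p v m with hp'
  have hv : p' v = m := Function.update_self ..
  have ha : p' a = p a := Function.update_of_ne hva.symm ..
  have hb : p' b = p b := Function.update_of_ne hvb.symm ..
  have hc : p' c = p c := Function.update_of_ne hvc.symm ..
  have hH' : ∀ t ∈ H, ∀ i, rRow p' t.1 (v, i) = 0 := fun t ht i => hH.rRow_apply p' ht i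
  have harea : area p' v a c ≠ 0 := by
    have : area p' v a c = - (area p a b c) / 2 := by
      simp only [area, hv, ha, hc, hm]
      ring
    rw [this]
    exact div_ne_zero (neg_ne_zero.2 hp) two_ne_zero
  refine (linearIndepOn_insert_two hH' hva hvc harea wa wc (hH.linearIndepOn_update m h)).insert ?_
  intro hmem
  rw [Set.image_insert_eq, Submodule.mem_span_insert] at hmem
  obtain ⟨α, x, hx, he⟩ := hmem
  rw [Set.image_insert_eq, Submodule.mem_span_insert] at hx
  obtain ⟨β, y, hy, rfl⟩ := hx
  have key : ∀ i, m i - p b i = α * (m i - p a i) + β * (m i - p c i) := by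
    intro i
    have := congrFun he (.inl (v, i))
    rw [Pi.add_apply, Pi.add_apply, Avoids.span_apply hH' hy, Pi.smul_apply, Pi.smul_apply,
      wRow_inl, wRow_inl, wRow_inl, rRow_self p' hva, rRow_self p' hvb, rRow_self p' hvc,
      hv, ha, hb, hc] at this
    simpa using this
  have h0 := key 0
  have h1 := key 1
  rw [hm] at h0 h1
  have hβ : β = 0 := by
    have : β * area p a b c = 0 := by
      rw [area]
      linear_combination (p a 1 - p b 1) * h0 - (p a 0 - p b 0) * h1
    exact (mul_eq_zero.1 this).resolve_right hp
  subst hβ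
  have hα : α = -1 := by
    have hz : ∀ i, (α + 1) * (p b i - p a i) = 0 := by
      intro i
      have := key i
      rw [hm] at this
      linear_combination -2 * this
    by_contra hne
    have hne' : α + 1 ≠ 0 := fun h => hne (by linarith)
    have e0 := (mul_eq_zero.1 (hz 0)).resolve_left hne'
    have e1 := (mul_eq_zero.1 (hz 1)).resolve_left hne'
    exact hp (by rw [area, e0, e1]; ring)
  subst hα
  rw [hH.image_update] at hy
  apply hab
  have hfin : wRow p (s(a, b), 0) =
      (2 : ℝ) • (y - wRow p (s(z, z), wa) - wRow p (s(z, z), wb)) := by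
    ext x
    have hex := congrFun he x
    rcases x with ⟨x, i⟩ | ℓ
    · simp only [Pi.add_apply, Pi.smul_apply, wRow_inl, rRow_mk, hv, ha, hb, hm,
        smul_eq_mul, Pi.sub_apply] at hex ⊢
      by_cases hxv : x = v
      · subst hxv
        simp only [hva, hvb, hvc, if_true, if_false, sub_self, ite_self, add_zero] at hex ⊢
        linarith
      · simp only [hxv, if_false, sub_self, ite_self, add_zero] at hex ⊢
        split_ifs at hex ⊢ <;> linarith
    · simp only [Pi.add_apply, Pi.smul_apply, wRow_inr, smul_eq_mul, Pi.sub_apply, Pi.zero_apply,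
        Rat.cast_zero] at hex ⊢
      linarith
  rw [hfin]
  exact Submodule.smul_mem _ _ (Submodule.sub_mem _ (Submodule.sub_mem _ hy hwa) hwb)

/-- A vertex of degree three can be added to an independent set of rows at a generic configuration,
unless all weights at the new vertex, and all edges between its neighbours, depend on the old
rows. -/
theorem Generic.linearIndepOn_insert_three {p : Cfg V 2} (hp : Generic p)
    {H : Set (Sym2 V × (Fin 2 → ℚ))} (hfin : H.Finite) {v a b c : V} (hH : Avoids H v)
    (hva : v ≠ a) (hvb : v ≠ b) (hvc : v ≠ c) (hab : a ≠ b) (hac : a ≠ c) (hbc : b ≠ c)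
    (wa wb wc : Fin 2 → ℚ) (h : LinearIndepOn ℝ (wRow p) H)
    (hspan : ∃ t ∈ ({(s(v, v), wa), (s(v, v), wb), (s(v, v), wc), (s(a, b), 0), (s(b, c), 0),
      (s(a, c), 0)} : Set (Sym2 V × (Fin 2 → ℚ))),
      wRow p t ∉ Submodule.span ℝ (wRow p '' H)) :
    LinearIndepOn ℝ (wRow p)
      (insert (s(v, a), wa) (insert (s(v, b), wb) (insert (s(v, c), wc) H))) := by
  have harea : area p a b c ≠ 0 := hp.area_ne_zero hab hac hbc
  have harea' : area p b c a ≠ 0 := hp.area_ne_zero hbc hab.symm hac.symm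
  have harea'' : area p c a b ≠ 0 := hp.area_ne_zero hac.symm hbc.symm hab
  have hfin' : (insert (s(v, a), wa) (insert (s(v, b), wb) (insert (s(v, c), wc) H))).Finite :=
    ((hfin.insert _).insert _).insert _
  by_cases h1 : wRow p (s(v, v), wa) ∈ Submodule.span ℝ (wRow p '' H)
  swap
  · obtain ⟨q, hq⟩ := exists_linearIndepOn_of_weight hH hva hvb hvc harea wa wb wc h h1
    refine hp.linearIndepOn_wRow hfin' (hq.mono ?_)
    grind
  by_cases h2 : wRow p (s(v, v), wb) ∈ Submodule.span ℝ (wRow p '' H)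
  swap
  · obtain ⟨q, hq⟩ := exists_linearIndepOn_of_weight hH hvb hvc hva harea' wb wc wa h h2
    refine hp.linearIndepOn_wRow hfin' (hq.mono ?_)
    grind
  by_cases h3 : wRow p (s(v, v), wc) ∈ Submodule.span ℝ (wRow p '' H)
  swap
  · obtain ⟨q, hq⟩ := exists_linearIndepOn_of_weight hH hvc hva hvb harea'' wc wa wb h h3
    refine hp.linearIndepOn_wRow hfin' (hq.mono ?_)
    grind
  obtain ⟨t, ht, hns⟩ := hspan
  simp only [Set.mem_insert_iff, Set.mem_singleton_iff] at ht
  rcases ht with rfl | rfl | rfl | rfl | rfl | rfl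
  · exact absurd h1 hns
  · exact absurd h2 hns
  · exact absurd h3 hns
  · obtain ⟨q, hq⟩ := exists_linearIndepOn_of_edge hH hva hvb hvc harea wa wb wc h h1 h2 hns
    refine hp.linearIndepOn_wRow hfin' (hq.mono ?_)
    grind
  · obtain ⟨q, hq⟩ := exists_linearIndepOn_of_edge hH hvb hvc hva harea' wb wc wa h h2 h3 hns
    refine hp.linearIndepOn_wRow hfin' (hq.mono ?_)
    grind
  · rw [Sym2.eq_swap] at hns
    obtain ⟨q, hq⟩ := exists_linearIndepOn_of_edge hH hvc hva hvb harea'' wc wa wb h h3 h1 hns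
    refine hp.linearIndepOn_wRow hfin' (hq.mono ?_)
    grind

/-! ### Rank functions -/

section SpanRank

variable {α M : Type*} [AddCommGroup M] [Module ℝ M] [FiniteDimensional ℝ M] (f : α → M)

/-- The rank of the image of a set under a map to a vector space. -/
noncomputable def spanRank (F : Set α) : ℕ :=
  Module.finrank ℝ (Submodule.span ℝ (f '' F))

theorem spanRank_mono {F F' : Set α} (h : F ⊆ F') : spanRank f F ≤ spanRank f F' :=
  Submodule.finrank_mono (Submodule.span_mono (Set.image_mono h))

theorem spanRank_union_add_inter (F F' : Set α) :
    spanRank f (F ∪ F') + spanRank f (F ∩ F') ≤ spanRank f F + spanRank f F' := by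
  have h : Submodule.span ℝ (f '' (F ∩ F')) ≤
      Submodule.span ℝ (f '' F) ⊓ Submodule.span ℝ (f '' F') :=
    le_inf (Submodule.span_mono (Set.image_mono Set.inter_subset_left))
      (Submodule.span_mono (Set.image_mono Set.inter_subset_right))
  have e := Submodule.finrank_sup_add_finrank_inf_eq (Submodule.span ℝ (f '' F))
    (Submodule.span ℝ (f '' F'))
  rw [← Submodule.span_union, ← Set.image_union] at e
  exact (Nat.add_le_add_left (Submodule.finrank_mono h) _).trans e.le

theorem spanRank_le_card (F : Finset α) : spanRank f F ≤ F.card := by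
  classical
  rw [spanRank, ← Finset.coe_image]
  exact (finrank_span_finset_le_card _).trans Finset.card_image_le

@[simp] theorem spanRank_empty : spanRank f ∅ = 0 := by simp [spanRank]

theorem spanRank_insert_le (x : α) (F : Set α) : spanRank f (insert x F) ≤ spanRank f F + 1 := by
  have h := spanRank_union_add_inter f F {x}
  have h1 := spanRank_le_card f {x}
  rw [Set.union_singleton] at h
  simp only [Finset.coe_singleton, Finset.card_singleton] at h1
  omega

theorem spanRank_insert_of_mem {x : α} {F : Set α} (h : f x ∈ Submodule.span ℝ (f '' F)) :
    spanRank f (insert x F) = spanRank f F := by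
  rw [spanRank, Set.image_insert_eq, Submodule.span_insert_eq_span h, spanRank]

theorem spanRank_insert_of_notMem {x : α} {F : Set α} (h : f x ∉ Submodule.span ℝ (f '' F)) :
    spanRank f F + 1 ≤ spanRank f (insert x F) := by
  refine Submodule.finrank_lt_finrank_of_lt ((Submodule.span_mono ?_).lt_of_not_ge fun hle => h ?_)
  · exact Set.image_mono (Set.subset_insert x F)
  · exact hle (Submodule.subset_span (Set.mem_image_of_mem f (Set.mem_insert x F)))

theorem spanRank_eq_card_of_linearIndepOn {F : Finset α} (h : LinearIndepOn ℝ f (F : Set α)) :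
    spanRank f (F : Set α) = F.card := by
  have h1 : LinearIndependent ℝ fun x : (F : Set α) => f x := h
  have h2 := finrank_span_eq_card h1
  rw [spanRank, Set.image_eq_range, h2]
  simp

theorem linearIndepOn_of_card_le_spanRank {F : Finset α} (h : F.card ≤ spanRank f (F : Set α)) :
    LinearIndepOn ℝ f (F : Set α) := by
  change LinearIndependent ℝ fun x : (F : Set α) => f x
  rw [linearIndependent_iff_card_le_finrank_span, Set.finrank, ← Set.image_eq_range]
  simpa [spanRank] using h

end SpanRank

/-! ### The rank bound coming from trivial motions -/

/-- The three infinitesimal rigid motions of the plane: two translations and a rotation. -/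
def trivialMotion (p : Cfg V 2) : Fin 3 → V × Fin 2 → ℝ :=
  ![fun x => if x.2 = 0 then 1 else 0, fun x => if x.2 = 0 then 0 else 1,
    fun x => if x.2 = 0 then - p x.1 1 else p x.1 0]

theorem sum_rRow_mul (p : Cfg V d) (z : V × Fin d → ℝ) {X : Finset V} {a b : V} (ha : a ∈ X)
    (hb : b ∈ X) : ∑ v ∈ X, ∑ i, rRow p s(a, b) (v, i) * z (v, i) =
      ∑ i, (p b i - p a i) * (z (b, i) - z (a, i)) := by
  rw [Finset.sum_comm]
  refine Finset.sum_congr rfl fun i _ => ?_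
  simp only [rRow_mk, add_mul, ite_mul, zero_mul, Finset.sum_add_distrib, Finset.sum_ite_eq', ha,
    hb, if_true]
  ring

theorem sum_rRow_mul_trivialMotion (p : Cfg V 2) (j : Fin 3) {X : Finset V} {a b : V} (ha : a ∈ X)
    (hb : b ∈ X) : ∑ v ∈ X, ∑ i, rRow p s(a, b) (v, i) * trivialMotion p j (v, i) = 0 := by
  rw [sum_rRow_mul p _ ha hb, Fin.sum_univ_two]
  fin_cases j <;> simp [trivialMotion]
  ring

theorem linearIndependent_trivialMotion {p : Cfg V 2} {X : Finset V} {a b : V} (ha : a ∈ X)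
    (hb : b ∈ X) (hab : p a 0 ≠ p b 0) :
    LinearIndependent ℝ fun j => fun y : X × Fin 2 => trivialMotion p j (y.1, y.2) := by
  rw [Fintype.linearIndependent_iff]
  intro c hc
  have h : ∀ v ∈ X, c 0 - c 2 * p v 1 = 0 ∧ c 1 + c 2 * p v 0 = 0 := by
    intro v hv
    have h0 := congrFun hc (⟨v, hv⟩, 0)
    have h1 := congrFun hc (⟨v, hv⟩, 1)
    simp [Fin.sum_univ_three, trivialMotion] at h0 h1
    constructor <;> linarith
  obtain ⟨ha0, ha1⟩ := h a ha
  obtain ⟨hb0, hb1⟩ := h b hb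
  have h2 : c 2 = 0 := by
    have : c 2 * (p a 0 - p b 0) = 0 := by linarith
    exact (mul_eq_zero.1 this).resolve_right (sub_ne_zero.2 hab)
  rw [h2] at ha0 ha1
  intro j
  fin_cases j
  · simpa using ha0
  · simpa using ha1
  · exact h2

theorem spanRank_rRow_le {p : Cfg V 2} {X : Finset V} {a b : V} (ha : a ∈ X)
    (hb : b ∈ X) (hab : p a 0 ≠ p b 0) {F : Set (Sym2 V)}
    (hF : ∀ e ∈ F, ¬ e.IsDiag → ∀ v ∈ e, v ∈ X) : spanRank (rRow p) F ≤ 2 * X.card - 3 := by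
  let A : Matrix (Fin 3) (X × Fin 2) ℝ := fun j y => trivialMotion p j (y.1, y.2)
  have hrank : A.rank = 3 := by
    have : LinearIndependent ℝ A.row := linearIndependent_trivialMotion ha hb hab
    simpa using this.rank_matrix
  have hker : Module.finrank ℝ (LinearMap.ker A.mulVecLin) = 2 * X.card - 3 := by
    have h := LinearMap.finrank_range_add_finrank_ker A.mulVecLin
    change A.rank + _ = _ at h
    simp only [Module.finrank_fintype_fun_eq_card, Fintype.card_prod, Fintype.card_coe,
      Fintype.card_fin] at h
    omega
  let W := Submodule.span ℝ (rRow p '' F)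
  let res : (V × Fin 2 → ℝ) →ₗ[ℝ] (X × Fin 2 → ℝ) :=
    LinearMap.funLeft ℝ ℝ fun y : X × Fin 2 => ((y.1 : V), y.2)
  have hzero : ∀ z ∈ W, ∀ v ∉ X, ∀ i, z (v, i) = 0 := by
    intro z hz v hv i
    induction hz using Submodule.span_induction with
    | mem x hx =>
      obtain ⟨e, he, rfl⟩ := hx
      by_cases hd : e.IsDiag
      · rw [rRow_diag p e hd]; rfl
      · exact rRow_apply_of_notMem p (fun hve => hv (hF e he hd v hve)) i
    | zero => rfl
    | add x y _ _ hx hy => simp [hx, hy]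
    | smul a x _ hx => simp [hx]
  have hW : ∀ z : W, res.domRestrict W z ∈ LinearMap.ker A.mulVecLin := by
    rintro ⟨z, hz⟩
    rw [LinearMap.domRestrict_apply]
    change res z ∈ LinearMap.ker A.mulVecLin
    induction hz using Submodule.span_induction with
    | mem x hx =>
      obtain ⟨e, he, rfl⟩ := hx
      by_cases hd : e.IsDiag
      · rw [rRow_diag p e hd, map_zero]
        exact Submodule.zero_mem _
      have hX := hF e he hd
      induction e with | h u v =>
      rw [LinearMap.mem_ker]
      ext j
      simp only [Matrix.mulVecLin_apply, Matrix.mulVec, dotProduct, Pi.zero_apply]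
      rw [Fintype.sum_prod_type, ← sum_rRow_mul_trivialMotion p j (hX u (by simp)) (hX v (by simp)),
        ← Finset.sum_coe_sort X]
      refine Finset.sum_congr rfl fun x _ => Finset.sum_congr rfl fun i _ => ?_
      rw [mul_comm]
      rfl
    | zero =>
      rw [map_zero]
      exact Submodule.zero_mem _
    | add x y _ _ hx hy =>
      rw [map_add]
      exact Submodule.add_mem _ hx hy
    | smul a x _ hx =>
      rw [map_smul]
      exact Submodule.smul_mem _ _ hx
  have hinj : Function.Injective ((res.domRestrict W).codRestrict _ hW) := by
    rw [injective_iff_map_eq_zero]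
    rintro ⟨z, hz⟩ h
    rw [Subtype.ext_iff] at h ⊢
    change res z = 0 at h
    change z = 0
    ext ⟨v, i⟩
    by_cases hv : v ∈ X
    · exact congrFun h (⟨v, hv⟩, i)
    · exact hzero z hz v hv i
  rw [← hker]
  exact LinearMap.finrank_le_finrank_of_injective hinj

/-! ### A Rado-type condition for two representations -/

section Rado

variable {α M N : Type*} [DecidableEq α] [AddCommGroup M] [Module ℝ M] [FiniteDimensional ℝ M]
  [AddCommGroup N] [Module ℝ N] [FiniteDimensional ℝ N] {f : α → M} {g : α → N}

/-- The counting condition characterising independence in the union of the linear matroids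
represented by `f` and `g`. -/
def Rado (f : α → M) (g : α → N) (S : Finset α) : Prop :=
  ∀ F ⊆ S, F.card ≤ spanRank f (F : Set α) + spanRank g (F : Set α)

theorem Rado.mono {S S' : Finset α} (h : Rado f g S') (hS : S ⊆ S') : Rado f g S :=
  fun F hF => h F (hF.trans hS)

/-- There is a largest subset for which the counting condition is tight. -/
theorem Rado.exists_tight {S : Finset α} (h : Rado f g S) :
    ∃ T ⊆ S, T.card = spanRank f (T : Set α) + spanRank g (T : Set α) ∧
      ∀ F ⊆ S, spanRank f (F : Set α) + spanRank g (F : Set α) ≤ F.card → F ⊆ T := by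
  let P : Finset (Finset α) :=
    S.powerset.filter fun F => spanRank f (F : Set α) + spanRank g (F : Set α) ≤ F.card
  have hP : P.Nonempty := ⟨∅, by simp [P]⟩
  obtain ⟨T, hT, hmax⟩ := P.exists_max_image Finset.card hP
  simp only [P, Finset.mem_filter, Finset.mem_powerset] at hT hmax
  refine ⟨T, hT.1, le_antisymm (h T hT.1) hT.2, fun F hF hFt => ?_⟩
  have h1 := spanRank_union_add_inter f (F : Set α) T
  have h2 := spanRank_union_add_inter g (F : Set α) T
  have h3 := h (F ∩ T) (Finset.inter_subset_left.trans hF)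
  have h4 := Finset.card_union_add_card_inter F T
  have hu := hmax (F ∪ T) ⟨Finset.union_subset hF hT.1, by push_cast at h3 ⊢; omega⟩
  exact Finset.subset_union_left.trans
    (Finset.eq_of_subset_of_card_le Finset.subset_union_right hu).ge

theorem Rado.insert_of_notMem_span {S T : Finset α} (h : Rado f g S)
    (hT : ∀ F ⊆ S, spanRank f (F : Set α) + spanRank g (F : Set α) ≤ F.card → F ⊆ T) {y : α}
    (hy : f y ∈ Submodule.span ℝ (f '' T) → g y ∉ Submodule.span ℝ (g '' T)) :
    Rado f g (insert y S) := by
  intro F hF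
  by_cases hyF : y ∈ F
  swap
  · exact h F ((Finset.subset_insert_iff_of_notMem hyF).1 hF)
  have hF' : F.erase y ⊆ S := by rwa [← Finset.subset_insert_iff]
  have hcard := Finset.card_erase_add_one hyF
  have hm := spanRank_mono f (F := (F.erase y : Finset α)) (F' := F) (by simp)
  have hm' := spanRank_mono g (F := (F.erase y : Finset α)) (F' := F) (by simp)
  have hle := h _ hF'
  by_contra! hlt
  have hsub := hT _ hF' (by omega)
  have hins : insert y (F.erase y : Set α) = F := by
    rw [← Finset.coe_insert, Finset.insert_erase hyF]
  by_cases hf : f y ∈ Submodule.span ℝ (f '' (F.erase y : Finset α))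
  · have hg : g y ∉ Submodule.span ℝ (g '' (F.erase y : Finset α)) := fun hg =>
      hy (Submodule.span_mono (Set.image_mono (Finset.coe_subset.2 hsub)) hf)
        (Submodule.span_mono (Set.image_mono (Finset.coe_subset.2 hsub)) hg)
    have := spanRank_insert_of_notMem g hg
    rw [hins] at this
    omega
  · have := spanRank_insert_of_notMem f hf
    rw [hins] at this
    omega

theorem mem_of_right_mem_span {S T : Finset α} (hTS : T ⊆ S)
    (hT : ∀ F ⊆ S, spanRank f (F : Set α) + spanRank g (F : Set α) ≤ F.card → F ⊆ T)
    (hcard : T.card = spanRank f (T : Set α) + spanRank g (T : Set α)) {y : α} (hy : y ∈ S)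
    (hg : g y ∈ Submodule.span ℝ (g '' T)) : y ∈ T := by
  by_contra hyT
  refine hyT (hT (insert y T) (Finset.insert_subset hy hTS) ?_ (Finset.mem_insert_self y T))
  have h1 := spanRank_insert_le f y T
  have h2 := spanRank_insert_of_mem g hg
  rw [Finset.card_insert_of_notMem hyT, Finset.coe_insert]
  omega

theorem mem_of_left_mem_span {S T : Finset α} (hTS : T ⊆ S)
    (hT : ∀ F ⊆ S, spanRank f (F : Set α) + spanRank g (F : Set α) ≤ F.card → F ⊆ T)
    (hcard : T.card = spanRank f (T : Set α) + spanRank g (T : Set α)) {y : α} (hy : y ∈ S)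
    (hf : f y ∈ Submodule.span ℝ (f '' T)) : y ∈ T := by
  by_contra hyT
  refine hyT (hT (insert y T) (Finset.insert_subset hy hTS) ?_ (Finset.mem_insert_self y T))
  have h1 := spanRank_insert_le g y T
  have h2 := spanRank_insert_of_mem f hf
  rw [Finset.card_insert_of_notMem hyT, Finset.coe_insert]
  omega

end Rado

/-! ### Weighted graphs: removing a vertex of small degree -/

/-- The edges of the weighted graph `S` at the vertex `v`, ignoring loops. -/
def starAt (S : Finset (Sym2 V × (Fin 2 → ℚ))) (v : V) : Finset (Sym2 V × (Fin 2 → ℚ)) :=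
  S.filter fun t => ¬ t.1.IsDiag ∧ v ∈ t.1

/-- The loops of the weighted graph `S`, and the edges avoiding the vertex `v`. -/
def deleteAt (S : Finset (Sym2 V × (Fin 2 → ℚ))) (v : V) : Finset (Sym2 V × (Fin 2 → ℚ)) :=
  S.filter fun t => ¬ (¬ t.1.IsDiag ∧ v ∈ t.1)

/-- All edges of the weighted graph `S` other than loops have their end vertices in `A`. -/
def Within (S : Finset (Sym2 V × (Fin 2 → ℚ))) (A : Finset V) : Prop :=
  ∀ t ∈ S, ¬ t.1.IsDiag → ∀ v ∈ t.1, v ∈ A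

/-- The weighted graph `S` has no parallel edges other than loops. -/
def Simple (S : Finset (Sym2 V × (Fin 2 → ℚ))) : Prop :=
  ∀ t ∈ S, ∀ t' ∈ S, ¬ t.1.IsDiag → t.1 = t'.1 → t = t'

theorem starAt_union_deleteAt (S : Finset (Sym2 V × (Fin 2 → ℚ))) (v : V) :
    starAt S v ∪ deleteAt S v = S :=
  Finset.filter_union_filter_not_eq _ _

theorem deleteAt_subset (S : Finset (Sym2 V × (Fin 2 → ℚ))) (v : V) : deleteAt S v ⊆ S :=
  Finset.filter_subset _ _

theorem avoids_deleteAt (S : Finset (Sym2 V × (Fin 2 → ℚ))) (v : V) :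
    Avoids (deleteAt S v : Set (Sym2 V × (Fin 2 → ℚ))) v := by
  intro t ht hd hv
  exact (Finset.mem_filter.1 ht).2 ⟨hd, hv⟩

theorem Within.deleteAt {S : Finset (Sym2 V × (Fin 2 → ℚ))} {A : Finset V} (h : Within S A)
    (v : V) : Within (deleteAt S v) (A.erase v) := by
  intro t ht hd u hu
  refine Finset.mem_erase.2 ⟨?_, h t (deleteAt_subset S v ht) hd u hu⟩
  rintro rfl
  exact avoids_deleteAt S u t ht hd hu

theorem Simple.mono {S S' : Finset (Sym2 V × (Fin 2 → ℚ))} (h : Simple S') (hS : S ⊆ S') :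
    Simple S :=
  fun t ht t' ht' => h t (hS ht) t' (hS ht')

theorem exists_card_starAt_le_three {S : Finset (Sym2 V × (Fin 2 → ℚ))} {A : Finset V}
    (hA : A.Nonempty) (hSA : Within S A)
    (hcard : (S.filter fun t => ¬ t.1.IsDiag).card ≤ 2 * A.card - 1) :
    ∃ v ∈ A, (starAt S v).card ≤ 3 := by
  by_contra! h
  have h1 : ∑ v ∈ A, 4 ≤ ∑ v ∈ A, (starAt S v).card := Finset.sum_le_sum fun v hv => h v hv
  have h2 : ∑ v ∈ A, (starAt S v).card = ∑ t ∈ S.filter fun t => ¬ t.1.IsDiag, 2 := by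
    have := Finset.sum_card_bipartiteAbove_eq_sum_card_bipartiteBelow (s := A)
      (t := S.filter fun t => ¬ t.1.IsDiag) fun v t => v ∈ t.1
    simp only [Finset.bipartiteAbove, Finset.bipartiteBelow, Finset.filter_filter] at this
    simp only [starAt]
    rw [this]
    refine Finset.sum_congr rfl fun t ht => ?_
    rw [Finset.mem_filter] at ht
    obtain ⟨⟨e, w⟩, ht, hd⟩ := t, ht
    induction e with | h x y =>
    have hxy : x ≠ y := by simpa using hd
    have : A.filter (fun v => v ∈ s(x, y)) = {x, y} := by
      ext u
      have := hSA _ ht hd u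
      simp only [Finset.mem_filter, Finset.mem_insert, Finset.mem_singleton]
      simp at this ⊢
      exact this
    rw [this, Finset.card_pair hxy]
  have := hA.card_pos
  rw [h2] at h1
  simp only [Finset.sum_const, smul_eq_mul] at h1
  omega

theorem exists_eq_of_mem_starAt {S : Finset (Sym2 V × (Fin 2 → ℚ))} {v : V}
    {t : Sym2 V × (Fin 2 → ℚ)} (ht : t ∈ starAt S v) : ∃ a, v ≠ a ∧ t = (s(v, a), t.2) := by
  obtain ⟨-, hd, a, ha⟩ := Finset.mem_filter.1 ht
  refine ⟨a, fun hva => hd ?_, Prod.ext ha rfl⟩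
  rw [ha, hva]
  exact Sym2.mk_isDiag_iff.2 rfl

/-- A vertex of degree at most three can be added to an independent set of rows, if in the
case of degree three the condition of `Generic.linearIndepOn_insert_three` is satisfied. -/
theorem Generic.linearIndepOn_of_deleteAt {p : Cfg V 2} (hp : Generic p)
    {S : Finset (Sym2 V × (Fin 2 → ℚ))} (hS : Simple S) {v : V} (hv : (starAt S v).card ≤ 3)
    (h : LinearIndepOn ℝ (wRow p) (deleteAt S v : Set (Sym2 V × (Fin 2 → ℚ))))
    (h3 : ∀ a b c wa wb wc, v ≠ a → v ≠ b → v ≠ c → a ≠ b → a ≠ c → b ≠ c →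
      starAt S v = {(s(v, a), wa), (s(v, b), wb), (s(v, c), wc)} →
      ∃ t ∈ ({(s(v, v), wa), (s(v, v), wb), (s(v, v), wc), (s(a, b), 0), (s(b, c), 0),
        (s(a, c), 0)} : Set (Sym2 V × (Fin 2 → ℚ))),
        wRow p t ∉ Submodule.span ℝ (wRow p '' deleteAt S v)) :
    LinearIndepOn ℝ (wRow p) (S : Set (Sym2 V × (Fin 2 → ℚ))) := by
  have hu := starAt_union_deleteAt S v
  have hav := avoids_deleteAt S v
  have hzero := fun t ht i => hav.rRow_apply p (t := t) ht i
  have hfin := (deleteAt S v).finite_toSet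
  have hne : ∀ {t t' : Sym2 V × (Fin 2 → ℚ)} {a b : V}, t ∈ starAt S v → t' ∈ starAt S v →
      t = (s(v, a), t.2) → t' = (s(v, b), t'.2) → t ≠ t' → a ≠ b := by
    rintro t t' a b ht ht' hta htb hne rfl
    rw [starAt, Finset.mem_filter] at ht ht'
    exact hne (hS t ht.1 t' ht'.1 ht.2.1 (by rw [hta, htb]))
  obtain h0 | h1 | h2 | h3' : (starAt S v).card = 0 ∨ (starAt S v).card = 1 ∨
      (starAt S v).card = 2 ∨ (starAt S v).card = 3 := by omega
  · rw [Finset.card_eq_zero] at h0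
    rw [h0, Finset.empty_union] at hu
    rwa [hu] at h
  · obtain ⟨t, ht⟩ := Finset.card_eq_one.1 h1
    obtain ⟨a, hva, hta⟩ := exists_eq_of_mem_starAt (S := S) (v := v) (t := t) (by simp [ht])
    rw [← hu, ht, Finset.coe_union, Finset.coe_singleton, Set.singleton_union]
    have hns := notMem_span_of_ne hzero hva
      (_root_.sub_ne_zero.1 (hp.sub_ne_zero hva)) t.2
    rw [← hta] at hns
    exact h.insert hns
  · obtain ⟨t, t', htt', ht⟩ := Finset.card_eq_two.1 h2
    have hm : t ∈ starAt S v := by simp [ht]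
    have hm' : t' ∈ starAt S v := by simp [ht]
    obtain ⟨a, hva, hta⟩ := exists_eq_of_mem_starAt hm
    obtain ⟨b, hvb, htb⟩ := exists_eq_of_mem_starAt hm'
    have := linearIndepOn_insert_two hzero hva hvb
      (hp.area_ne_zero hva hvb (hne hm hm' hta htb htt')) t.2 t'.2 h
    rw [← hta, ← htb] at this
    rw [← hu, ht, Finset.coe_union, Finset.coe_insert, Finset.coe_singleton, Set.insert_union,
      Set.singleton_union]
    exact this
  · obtain ⟨t, t', t'', h12, h13, h23, ht⟩ := Finset.card_eq_three.1 h3'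
    have hm : t ∈ starAt S v := by simp [ht]
    have hm' : t' ∈ starAt S v := by simp [ht]
    have hm'' : t'' ∈ starAt S v := by simp [ht]
    obtain ⟨a, hva, hta⟩ := exists_eq_of_mem_starAt hm
    obtain ⟨b, hvb, htb⟩ := exists_eq_of_mem_starAt hm'
    obtain ⟨c, hvc, htc⟩ := exists_eq_of_mem_starAt hm''
    have hab := hne hm hm' hta htb h12
    have hac := hne hm hm'' hta htc h13
    have hbc := hne hm' hm'' htb htc h23
    have := hp.linearIndepOn_insert_three hfin hav hva hvb hvc hab hac hbc t.2 t'.2 t''.2 h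
      (h3 a b c t.2 t'.2 t''.2 hva hvb hvc hab hac hbc (by rw [← hta, ← htb, ← htc, ht]))
    rw [← hta, ← htb, ← htc] at this
    rw [← hu, ht, Finset.coe_union, Finset.coe_insert, Finset.coe_insert, Finset.coe_singleton,
      Set.insert_union, Set.insert_union, Set.singleton_union]
    exact this

/-! ### Independence from the Rado-type condition -/

/-- If the edges between `a`, `b` and `c` are implied, then two bars from `v` to these vertices
imply the third one. -/
theorem rRow_mem_span_of_triangle {p : Cfg V 2} {W : Submodule ℝ (V × Fin 2 → ℝ)} {v a b c : V}
    (hvab : area p v a b ≠ 0) (habc : area p a b c ≠ 0)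
    (hva : rRow p s(v, a) ∈ W) (hvb : rRow p s(v, b) ∈ W) (hab : rRow p s(a, b) ∈ W)
    (hbc : rRow p s(b, c) ∈ W) (hac : rRow p s(a, c) ∈ W) : rRow p s(v, c) ∈ W := by
  have key : (area p a b c * area p v a b) • rRow p s(v, c) =
      (area p v b c * area p v c a) • rRow p s(a, b) +
      (area p v c a * area p v a b) • rRow p s(b, c) +
      (area p v b c * area p v a b) • rRow p s(a, c) -
      (area p a b c * area p v b c) • rRow p s(v, a) -
      (area p a b c * area p v c a) • rRow p s(v, b) := by
    ext ⟨x, i⟩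
    have hrow : ∀ y z, rRow p s(y, z) (x, i) =
        ((if x = y then 1 else 0) - (if x = z then 1 else 0)) * (p y i - p z i) := by
      intro y z
      rw [rRow_mk]
      split_ifs <;> ring
    simp only [Pi.add_apply, Pi.sub_apply, Pi.smul_apply, smul_eq_mul, hrow, area]
    fin_cases i <;> simp only [Fin.zero_eta, Fin.mk_one] <;> ring
  rw [← W.smul_mem_iff (mul_ne_zero habc hvab), key]
  exact W.sub_mem (W.sub_mem (W.add_mem (W.add_mem (W.smul_mem _ hab) (W.smul_mem _ hbc))
    (W.smul_mem _ hac)) (W.smul_mem _ hva)) (W.smul_mem _ hvb)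

/-- The row of the rigidity matrix of the edge of a weighted edge. -/
noncomputable def eRow (p : Cfg V 2) (t : Sym2 V × (Fin 2 → ℚ)) : V × Fin 2 → ℝ :=
  rRow p t.1

theorem spanRank_weight_le (F : Set (Sym2 V × (Fin 2 → ℚ))) : spanRank weight F ≤ 2 := by
  have := Submodule.finrank_le (Submodule.span ℝ (weight '' F))
  rwa [Module.finrank_fin_fun] at this

theorem spanRank_eRow (p : Cfg V 2) (F : Set (Sym2 V × (Fin 2 → ℚ))) :
    spanRank (eRow p) F = spanRank (rRow p) (Prod.fst '' F) := by
  rw [spanRank, spanRank, Set.image_image]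
  rfl

theorem Rado.card_filter_le {p : Cfg V 2} (hp : Generic p) {A : Finset V} (hA : A.Nonempty)
    {S : Finset (Sym2 V × (Fin 2 → ℚ))} (hSA : Within S A) (hR : Rado (eRow p) weight S) :
    (S.filter fun t => ¬ t.1.IsDiag).card ≤ 2 * A.card - 1 := by
  obtain ⟨a, ha⟩ := hA
  by_cases hA2 : ∃ b ∈ A, a ≠ b
  · obtain ⟨b, hb, hab⟩ := hA2
    have h1 := hR _ (Finset.filter_subset (fun t => ¬ t.1.IsDiag) S)
    have h2 := spanRank_weight_le (S.filter fun t => ¬ t.1.IsDiag : Set (Sym2 V × (Fin 2 → ℚ)))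
    have h3 : spanRank (eRow p) (S.filter fun t => ¬ t.1.IsDiag : Set _) ≤ 2 * A.card - 3 := by
      rw [spanRank_eRow]
      refine spanRank_rRow_le ha hb (_root_.sub_ne_zero.1 (hp.sub_ne_zero hab)) ?_
      rintro _ ⟨t, ht, rfl⟩ hd
      exact hSA t (Finset.mem_filter.1 ht).1 hd
    have h4 : 1 < A.card := Finset.one_lt_card.2 ⟨a, ha, b, hb, hab⟩
    rw [Finset.coe_filter] at h1 h2
    rw [Finset.coe_filter] at h3
    omega
  · have : (S.filter fun t => ¬ t.1.IsDiag) = ∅ := by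
      rw [Finset.filter_eq_empty_iff]
      intro t ht hd
      have := hSA t ht hd
      obtain ⟨e, w⟩ := t
      induction e with | h x y =>
      push Not at hA2
      apply hd
      have hx := hA2 x (this x (by simp))
      have hy := hA2 y (this y (by simp))
      simp [← hx, ← hy]
    rw [this]
    simp

/-- At a generic configuration the Rado-type condition implies that the rows of a weighted graph
are independent. -/
theorem Rado.linearIndepOn_wRow {p : Cfg V 2} (hp : Generic p) (A : Finset V) :
    ∀ S : Finset (Sym2 V × (Fin 2 → ℚ)), Simple S → Within S A → Rado (eRow p) weight S →
      LinearIndepOn ℝ (wRow p) (S : Set (Sym2 V × (Fin 2 → ℚ))) := by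
  induction A using Finset.strongInduction with | H A ih =>
  intro S hS hSA hR
  obtain rfl | hA := A.eq_empty_or_nonempty
  · have hdiag : ∀ t ∈ S, t.1.IsDiag := by
      intro t ht
      by_contra hd
      obtain ⟨e, w⟩ := t
      induction e with | h x y =>
      exact absurd (hSA _ ht hd x (by simp)) (Finset.notMem_empty x)
    have hr : spanRank (eRow p) (S : Set (Sym2 V × (Fin 2 → ℚ))) = 0 := by
      have : Submodule.span ℝ (eRow p '' S) = ⊥ := by
        rw [Submodule.span_eq_bot]
        rintro _ ⟨t, ht, rfl⟩
        exact rRow_diag p _ (hdiag t ht)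
      rw [spanRank, this, finrank_bot]
    have hw := hR S subset_rfl
    rw [hr, zero_add] at hw
    have := linearIndepOn_of_card_le_spanRank weight hw
    exact LinearIndependent.of_comp (LinearMap.funLeft ℝ ℝ Sum.inr) this
  obtain ⟨v, hvA, hv⟩ := exists_card_starAt_le_three hA hSA (hR.card_filter_le hp hA hSA)
  have hlt := Finset.erase_ssubset hvA
  set H := deleteAt S v with hH
  have hHS : H ⊆ S := deleteAt_subset S v
  have hHsimple := hS.mono hHS
  have hHA : Within H (A.erase v) := hSA.deleteAt v
  have hHR := hR.mono hHS
  have hHI := ih _ hlt H hHsimple hHA hHR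
  refine hp.linearIndepOn_of_deleteAt hS hv hHI ?_
  intro a b c wa wb wc hva hvb hvc hab hac hbc hstar
  by_contra! hspan
  simp only [Set.mem_insert_iff, Set.mem_singleton_iff, forall_eq_or_imp, forall_eq] at hspan
  obtain ⟨ha, hb, hc, hab', hbc', hac'⟩ := hspan
  obtain ⟨T, hTH, hTcard, hTmax⟩ := hHR.exists_tight
  have hclosed : ∀ y : Sym2 V × (Fin 2 → ℚ), (¬ y.1.IsDiag → ∀ u ∈ y.1, u ∈ A.erase v) →
      (¬ y.1.IsDiag → ∀ t ∈ H, t.1 ≠ y.1) → wRow p y ∈ Submodule.span ℝ (wRow p '' H) →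
      eRow p y ∈ Submodule.span ℝ (eRow p '' T) ∧
        weight y ∈ Submodule.span ℝ (weight '' (T : Set (Sym2 V × (Fin 2 → ℚ)))) := by
    intro y hyA hysimple hyspan
    by_contra hcl
    rw [not_and] at hcl
    have hyH : y ∉ H := by
      intro hyH
      by_cases hd : y.1.IsDiag
      · have h0 : eRow p y ∈ Submodule.span ℝ (eRow p '' T) := by
          rw [eRow, rRow_diag p _ hd]
          exact Submodule.zero_mem _
        exact hcl h0 (Submodule.subset_span (Set.mem_image_of_mem _
          (mem_of_left_mem_span hTH hTmax hTcard hyH h0)))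
      · exact hysimple hd y hyH rfl
    have hins : LinearIndepOn ℝ (wRow p)
        ((insert y H : Finset _) : Set (Sym2 V × (Fin 2 → ℚ))) := by
      refine ih _ hlt _ ?_ ?_ (hHR.insert_of_notMem_span hTmax hcl)
      · intro t ht t' ht' hd htt'
        rw [Finset.mem_insert] at ht ht'
        obtain rfl | ht := ht <;> obtain rfl | ht' := ht'
        · rfl
        · exact absurd htt'.symm (hysimple hd t' ht')
        · exact absurd htt' (hysimple (htt' ▸ hd) t ht)
        · exact hHsimple t ht t' ht' hd htt'
      · intro t ht hd
        obtain rfl | ht := Finset.mem_insert.1 ht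
        · exact hyA hd
        · exact hHA t ht hd
    rw [Finset.coe_insert, linearIndepOn_insert (by exact_mod_cast hyH)] at hins
    exact hins.2 hyspan
  have hloop : ∀ w, wRow p (s(v, v), w) ∈ Submodule.span ℝ (wRow p '' H) →
      weight (s(v, v), w) ∈ Submodule.span ℝ (weight '' (T : Set (Sym2 V × (Fin 2 → ℚ)))) :=
    fun w hw =>
    (hclosed _ (fun h => absurd (Sym2.mk_isDiag_iff.2 rfl) h)
      (fun h => absurd (Sym2.mk_isDiag_iff.2 rfl) h) hw).2
  have hedge : ∀ x y : V, x ∈ A.erase v → y ∈ A.erase v →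
      wRow p (s(x, y), (0 : Fin 2 → ℚ)) ∈ Submodule.span ℝ (wRow p '' H) →
      rRow p s(x, y) ∈ Submodule.span ℝ (eRow p '' T) := by
    intro x y hx hy hxy
    by_cases hg : ∃ g ∈ H, g.1 = s(x, y)
    · obtain ⟨g, hg, hgxy⟩ := hg
      have hgspan : wRow p g ∈ Submodule.span ℝ (wRow p '' H) :=
        Submodule.subset_span (Set.mem_image_of_mem _ hg)
      have hl : wRow p (s(v, v), g.2) ∈ Submodule.span ℝ (wRow p '' H) := by
        have : wRow p (s(v, v), g.2) = wRow p g - wRow p (g.1, 0) := by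
          ext (x | ℓ)
          · simp [rRow_diag p s(v, v)]
          · simp
        rw [this, hgxy]
        exact Submodule.sub_mem _ hgspan hxy
      have hgT := mem_of_right_mem_span hTH hTmax hTcard hg (hloop g.2 hl)
      rw [← hgxy]
      exact Submodule.subset_span (Set.mem_image_of_mem _ hgT)
    · push Not at hg
      refine (hclosed (s(x, y), 0) (fun _ u hu => ?_) (fun _ => hg) hxy).1
      obtain rfl | rfl := Sym2.mem_iff.1 hu
      · exact hx
      · exact hy
  have hmem : ∀ x w, v ≠ x → (s(v, x), w) ∈ starAt S v → x ∈ A.erase v := by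
    intro x w hvx hx
    have := Finset.mem_filter.1 hx
    exact Finset.mem_erase.2 ⟨hvx.symm, hSA _ this.1 this.2.1 x (by simp)⟩
  have haA := hmem a wa hva (by simp [hstar])
  have hbA := hmem b wb hvb (by simp [hstar])
  have hcA := hmem c wc hvc (by simp [hstar])
  have hab'' := hedge a b haA hbA hab'
  have hbc'' := hedge b c hbA hcA hbc'
  have hac'' := hedge a c haA hcA hac'
  have hdisj : Disjoint (starAt S v) T := by
    rw [Finset.disjoint_left]
    intro t ht htT
    exact (Finset.mem_filter.1 (hTH htT)).2 (Finset.mem_filter.1 ht).2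
  have hcard : (starAt S v ∪ T).card = 3 + T.card := by
    rw [Finset.card_union_of_disjoint hdisj, hstar, Finset.card_eq_three.2]
    exact ⟨_, _, _, by simp [hab, hvb], by simp [hac, hvc], by simp [hbc, hvc], rfl⟩
  have hle := hR _ (Finset.union_subset (Finset.filter_subset _ _) (hTH.trans hHS) :
    starAt S v ∪ T ⊆ S)
  have hset : (starAt S v ∪ T : Set (Sym2 V × (Fin 2 → ℚ))) =
      insert (s(v, c), wc) (insert (s(v, a), wa) (insert (s(v, b), wb)
        (T : Set (Sym2 V × (Fin 2 → ℚ))))) := by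
    rw [hstar]
    push_cast
    ext t
    simp only [Set.mem_union, Set.mem_insert_iff, Set.mem_singleton_iff]
    tauto
  rw [hcard, Finset.coe_union, hset] at hle
  have hb1 := spanRank_insert_le (eRow p) (s(v, b), wb) (T : Set (Sym2 V × (Fin 2 → ℚ)))
  have ha1 := spanRank_insert_le (eRow p) (s(v, a), wa)
    (insert (s(v, b), wb) T : Set (Sym2 V × (Fin 2 → ℚ)))
  have hmono : Submodule.span ℝ (eRow p '' T) ≤
      Submodule.span ℝ (eRow p '' (insert (s(v, a), wa) (insert (s(v, b), wb) T))) :=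
    Submodule.span_mono (Set.image_mono
      ((Set.subset_insert _ _).trans (Set.subset_insert _ _)))
  have hc1 := spanRank_insert_of_mem (eRow p) (x := (s(v, c), wc))
    (F := insert (s(v, a), wa) (insert (s(v, b), wb) T))
    (rRow_mem_span_of_triangle (hp.area_ne_zero hva hvb hab) (hp.area_ne_zero hab hac hbc)
      (Submodule.subset_span ⟨(s(v, a), wa), by simp, rfl⟩)
      (Submodule.subset_span ⟨(s(v, b), wb), by simp, rfl⟩) (hmono hab'') (hmono hbc'')
      (hmono hac''))
  have hw1 := spanRank_insert_of_mem weight (x := (s(v, b), wb)) (hloop wb hb)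
  have hmono1 : Submodule.span ℝ (weight '' (T : Set (Sym2 V × (Fin 2 → ℚ)))) ≤
      Submodule.span ℝ (weight '' (insert (s(v, b), wb) T : Set (Sym2 V × (Fin 2 → ℚ)))) :=
    Submodule.span_mono (Set.image_mono (Set.subset_insert _ _))
  have hmono2 : Submodule.span ℝ (weight '' (insert (s(v, b), wb) T : Set _)) ≤
      Submodule.span ℝ (weight '' (insert (s(v, a), wa) (insert (s(v, b), wb) T) :
        Set (Sym2 V × (Fin 2 → ℚ)))) :=
    Submodule.span_mono (Set.image_mono (Set.subset_insert _ _))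
  have hw2 := spanRank_insert_of_mem weight (x := (s(v, a), wa)) (hmono1 (hloop wa ha))
  have hw3 := spanRank_insert_of_mem weight (x := (s(v, c), wc)) (hmono2 (hmono1 (hloop wc hc)))
  omega

/-! ### Laman's theorem -/

/-- Every set of `n ≥ 2` vertices spans at most `2 * n - 3` edges of `E`. -/
def IsSparse (E : Finset (Sym2 V)) : Prop :=
  ∀ X : Finset V, 2 ≤ X.card → (E ∩ X.sym2).card ≤ 2 * X.card - 3

theorem IsSparse.mono {E E' : Finset (Sym2 V)} (h : IsSparse E') (hE : E ⊆ E') : IsSparse E :=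
  fun X hX => (Finset.card_le_card (Finset.inter_subset_inter_right hE)).trans (h X hX)

theorem IsSparse.le_card_union {E : Finset (Sym2 V)} (h : IsSparse E) {X Y : Finset V}
    (hX : 2 * X.card - 3 ≤ (E ∩ X.sym2).card) (hY : 2 * Y.card - 3 ≤ (E ∩ Y.sym2).card)
    (hXY : 2 ≤ (X ∩ Y).card) : 2 * (X ∪ Y).card - 3 ≤ (E ∩ (X ∪ Y).sym2).card := by
  have h1 := Finset.card_union_add_card_inter X Y
  have h2 := Finset.card_union_add_card_inter (E ∩ X.sym2) (E ∩ Y.sym2)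
  have h3 : (E ∩ X.sym2) ∪ (E ∩ Y.sym2) ⊆ E ∩ (X ∪ Y).sym2 := by
    rw [← Finset.inter_union_distrib_left]
    exact Finset.inter_subset_inter_left (Finset.union_subset
      (Finset.sym2_mono Finset.subset_union_left) (Finset.sym2_mono Finset.subset_union_right))
  have h4 : (E ∩ X.sym2) ∩ (E ∩ Y.sym2) ⊆ E ∩ (X ∩ Y).sym2 := by
    intro e he
    simp only [Finset.mem_inter, Finset.mem_sym2_iff] at he ⊢
    exact ⟨he.1.1, fun v hv => ⟨he.1.2 v hv, he.2.2 v hv⟩⟩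
  have h5 := Finset.card_le_card h3
  have h6 := Finset.card_le_card h4
  have h7 := h _ hXY
  have h8 := Finset.card_le_card (Finset.inter_subset_left (s₁ := X) (s₂ := Y))
  have h9 := Finset.card_le_card (Finset.inter_subset_right (s₁ := X) (s₂ := Y))
  omega

theorem IsSparse.exists_tight {E : Finset (Sym2 V)} (h : IsSparse E) (hE : ∀ e ∈ E, ¬ e.IsDiag)
    {a b c : V} (hab : a ≠ b) (hac : a ≠ c) (hbc : b ≠ c) {X Y Z : Finset V}
    (hX : 2 * X.card - 3 ≤ (E ∩ X.sym2).card) (hY : 2 * Y.card - 3 ≤ (E ∩ Y.sym2).card)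
    (hZ : 2 * Z.card - 3 ≤ (E ∩ Z.sym2).card) (haX : a ∈ X) (hbX : b ∈ X) (hbY : b ∈ Y)
    (hcY : c ∈ Y) (haZ : a ∈ Z) (hcZ : c ∈ Z) :
    ∃ W ⊆ X ∪ Y ∪ Z, a ∈ W ∧ b ∈ W ∧ c ∈ W ∧ 2 * W.card - 3 ≤ (E ∩ W.sym2).card := by
  by_cases hXY : 2 ≤ (X ∩ Y).card
  · exact ⟨X ∪ Y, Finset.subset_union_left, by simp [haX], by simp [hbX], by simp [hcY],
      h.le_card_union hX hY hXY⟩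
  by_cases hXZ : 2 ≤ (X ∩ Z).card
  · exact ⟨X ∪ Z, by grind, by simp [haX], by simp [hbX], by simp [hcZ],
      h.le_card_union hX hZ hXZ⟩
  by_cases hYZ : 2 ≤ (Y ∩ Z).card
  · exact ⟨Y ∪ Z, by grind, by simp [haZ], by simp [hbY], by simp [hcZ],
      h.le_card_union hY hZ hYZ⟩
  refine ⟨X ∪ Y ∪ Z, subset_rfl, by simp [haX], by simp [hbX], by simp [hcY], ?_⟩
  have hdisj : ∀ X Y : Finset V, ¬ 2 ≤ (X ∩ Y).card → Disjoint (E ∩ X.sym2) (E ∩ Y.sym2) := by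
    intro X Y hXY
    rw [Finset.disjoint_left]
    intro e he he'
    simp only [Finset.mem_inter, Finset.mem_sym2_iff] at he he'
    have hd := hE e he.1
    induction e with | h x y =>
    refine hXY (Finset.one_lt_card.2 ⟨x, ?_, y, ?_, by simpa using hd⟩)
    · exact Finset.mem_inter.2 ⟨he.2 x (by simp), he'.2 x (by simp)⟩
    · exact Finset.mem_inter.2 ⟨he.2 y (by simp), he'.2 y (by simp)⟩
  have hsub : (E ∩ X.sym2) ∪ (E ∩ Y.sym2) ∪ (E ∩ Z.sym2) ⊆ E ∩ (X ∪ Y ∪ Z).sym2 := by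
    intro e he
    simp only [Finset.mem_inter, Finset.mem_union, Finset.mem_sym2_iff] at he ⊢
    grind
  have hle := Finset.card_le_card hsub
  rw [Finset.card_union_of_disjoint (Finset.disjoint_union_left.2 ⟨hdisj X Z hXZ, hdisj Y Z hYZ⟩),
    Finset.card_union_of_disjoint (hdisj X Y hXY)] at hle
  have h1 := Finset.card_union_add_card_inter X Y
  have h2 := Finset.card_union_add_card_inter (X ∪ Y) Z
  have h3 : 2 ≤ ((X ∪ Y) ∩ Z).card :=
    Finset.one_lt_card.2 ⟨a, by simp [haX, haZ], c, by simp [hcY, hcZ], hac⟩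
  have h4 : 1 ≤ (X ∩ Y).card := Finset.card_pos.2 ⟨b, by simp [hbX, hbY]⟩
  have h5 : 2 ≤ X.card := Finset.one_lt_card.2 ⟨a, haX, b, hbX, hab⟩
  have h6 : 2 ≤ Y.card := Finset.one_lt_card.2 ⟨b, hbY, c, hcY, hbc⟩
  have h7 : 2 ≤ Z.card := Finset.one_lt_card.2 ⟨a, haZ, c, hcZ, hac⟩
  omega

/-- A set of edges, all with weight zero. -/
def unweighted (E : Finset (Sym2 V)) : Finset (Sym2 V × (Fin 2 → ℚ)) :=
  E.image fun e => (e, 0)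

theorem mem_unweighted {E : Finset (Sym2 V)} {t : Sym2 V × (Fin 2 → ℚ)} :
    t ∈ unweighted E ↔ t.1 ∈ E ∧ t.2 = 0 := by
  obtain ⟨e, w⟩ := t
  simp [unweighted, eq_comm]

theorem unweighted_insert (e : Sym2 V) (E : Finset (Sym2 V)) :
    unweighted (insert e E) = insert (e, 0) (unweighted E) :=
  Finset.image_insert _ _ _

theorem IsSparse.linearIndepOn_wRow {p : Cfg V 2} (hp : Generic p) (A : Finset V) :
    ∀ E : Finset (Sym2 V), (∀ e ∈ E, ¬ e.IsDiag) → E ⊆ A.sym2 → IsSparse E →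
      LinearIndepOn ℝ (wRow p) (unweighted E : Set (Sym2 V × (Fin 2 → ℚ))) := by
  induction A using Finset.strongInduction with | H A ih =>
  intro E hE hEA hsp
  obtain rfl | hA := A.eq_empty_or_nonempty
  · rw [Finset.sym2_empty, Finset.subset_empty] at hEA
    subst hEA
    simp [unweighted]
  have hcard : E.card ≤ 2 * A.card - 1 := by
    have h1 := Finset.inter_eq_left.2 hEA
    by_cases h2 : 2 ≤ A.card
    · have := hsp A h2
      rw [h1] at this
      omega
    · have h3 : E = ∅ := by
        rw [Finset.eq_empty_iff_forall_notMem]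
        intro e he
        have hd := hE e he
        have heA := Finset.mem_sym2_iff.1 (hEA he)
        induction e with | h x y =>
        exact h2 (Finset.one_lt_card.2 ⟨x, heA x (by simp), y, heA y (by simp), by simpa using hd⟩)
      simp [h3]
  have hSA : Within (unweighted E) A := fun t ht _ =>
    Finset.mem_sym2_iff.1 (hEA (mem_unweighted.1 ht).1)
  obtain ⟨v, hvA, hv⟩ := exists_card_starAt_le_three hA hSA
    ((Finset.card_filter_le _ _).trans (Finset.card_image_le.trans hcard))
  have hlt := Finset.erase_ssubset hvA
  have hsimple : Simple (unweighted E) := fun t ht t' ht' _ h =>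
    Prod.ext h ((mem_unweighted.1 ht).2.trans (mem_unweighted.1 ht').2.symm)
  let E' := E.filter fun e => v ∉ e
  have hE'E : E' ⊆ E := Finset.filter_subset _ _
  have hdel : deleteAt (unweighted E) v = unweighted E' := by
    ext t
    simp only [deleteAt, Finset.mem_filter, mem_unweighted, E']
    grind
  have hE'A : E' ⊆ (A.erase v).sym2 := by
    intro e he
    rw [Finset.mem_sym2_iff]
    intro u hu
    refine Finset.mem_erase.2 ⟨?_, Finset.mem_sym2_iff.1 (hEA (hE'E he)) u hu⟩
    rintro rfl
    exact (Finset.mem_filter.1 he).2 hu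
  have hE'sp := hsp.mono hE'E
  have hE'd : ∀ e ∈ E', ¬ e.IsDiag := fun e he => hE e (hE'E he)
  have hI := ih _ hlt E' hE'd hE'A hE'sp
  refine hp.linearIndepOn_of_deleteAt hsimple hv (hdel ▸ hI) ?_
  intro a b c wa wb wc hva hvb hvc hab hac hbc hstar
  by_contra! hspan
  simp only [Set.mem_insert_iff, Set.mem_singleton_iff, forall_eq_or_imp, forall_eq] at hspan
  obtain ⟨-, -, -, hab', hbc', hac'⟩ := hspan
  have hmem : ∀ x w, (s(v, x), w) ∈ starAt (unweighted E) v → s(v, x) ∈ E ∧ x ∈ A := by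
    intro x w hx
    have := (mem_unweighted.1 (Finset.mem_filter.1 hx).1).1
    exact ⟨this, Finset.mem_sym2_iff.1 (hEA this) x (by simp)⟩
  obtain ⟨haE, haA⟩ := hmem a wa (by simp [hstar])
  obtain ⟨hbE, hbA⟩ := hmem b wb (by simp [hstar])
  obtain ⟨hcE, hcA⟩ := hmem c wc (by simp [hstar])
  have htight : ∀ x y, x ≠ y → v ≠ x → v ≠ y → x ∈ A → y ∈ A →
      wRow p (s(x, y), (0 : Fin 2 → ℚ)) ∈
        Submodule.span ℝ (wRow p '' deleteAt (unweighted E) v) →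
      ∃ X : Finset V, v ∉ X ∧ x ∈ X ∧ y ∈ X ∧ 2 * X.card - 3 ≤ (E' ∩ X.sym2).card := by
    intro x y hxy hvx hvy hx hy hspan
    by_cases hxyE : s(x, y) ∈ E'
    · refine ⟨{x, y}, by simp [hvx, hvy], by simp, by simp, ?_⟩
      rw [Finset.card_pair hxy]
      exact Finset.card_pos.2 ⟨s(x, y), by simp [hxyE]⟩
    have hns : ¬ IsSparse (insert s(x, y) E') := by
      intro hs
      have := ih _ hlt (insert s(x, y) E') (by simpa [hxy] using hE'd)
        (by simp [Finset.insert_subset_iff, hE'A, hx, hy, hvx.symm, hvy.symm]) hs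
      rw [unweighted_insert, Finset.coe_insert, linearIndepOn_insert
        (by simp [mem_unweighted, hxyE]), ← hdel] at this
      exact this.2 hspan
    rw [IsSparse] at hns
    push Not at hns
    obtain ⟨X, hX2, hX⟩ := hns
    have hxyX : s(x, y) ∈ X.sym2 := by
      by_contra hcon
      rw [Finset.insert_inter_of_notMem hcon] at hX
      exact absurd (hE'sp X hX2) (by omega)
    rw [Finset.insert_inter_of_mem hxyX, Finset.card_insert_of_notMem (by simp [hxyE])] at hX
    have hxX := Finset.mem_sym2_iff.1 hxyX x (by simp)
    have hyX := Finset.mem_sym2_iff.1 hxyX y (by simp)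
    refine ⟨X, fun hvX => ?_, hxX, hyX, by omega⟩
    have h1 : E' ∩ X.sym2 ⊆ E' ∩ (X.erase v).sym2 := by
      intro e he
      simp only [Finset.mem_inter, Finset.mem_sym2_iff] at he ⊢
      refine ⟨he.1, fun u hu => Finset.mem_erase.2 ⟨?_, he.2 u hu⟩⟩
      rintro rfl
      exact (Finset.mem_filter.1 he.1).2 hu
    have h2 : 1 < (X.erase v).card :=
      Finset.one_lt_card.2 ⟨x, by simp [hxX, hvx.symm], y, by simp [hyX, hvy.symm], hxy⟩
    have h3 := Finset.card_le_card h1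
    have h4 := hE'sp _ h2
    have h5 := Finset.card_erase_add_one hvX
    omega
  obtain ⟨X, hvX, haX, hbX, hX⟩ := htight a b hab hva hvb haA hbA hab'
  obtain ⟨Y, hvY, hbY, hcY, hY⟩ := htight b c hbc hvb hvc hbA hcA hbc'
  obtain ⟨Z, hvZ, haZ, hcZ, hZ⟩ := htight a c hac hva hvc haA hcA hac'
  obtain ⟨W, hWsub, haW, hbW, hcW, hW⟩ :=
    hE'sp.exists_tight hE'd hab hac hbc hX hY hZ haX hbX hbY hcY haZ hcZ
  have hvW : v ∉ W := fun h => by simpa [hvX, hvY, hvZ] using hWsub h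
  have hWcard : 1 < W.card := Finset.one_lt_card.2 ⟨a, haW, b, hbW, hab⟩
  have hins : ({s(v, a), s(v, b), s(v, c)} : Finset (Sym2 V)) ∪ (E' ∩ W.sym2) ⊆
      E ∩ (insert v W).sym2 := by
    refine Finset.union_subset ?_ (Finset.inter_subset_inter hE'E
      (Finset.sym2_mono (Finset.subset_insert v W)))
    simp [Finset.insert_subset_iff, haE, hbE, hcE, haW, hbW, hcW]
  have hdisj : Disjoint ({s(v, a), s(v, b), s(v, c)} : Finset (Sym2 V)) (E' ∩ W.sym2) := by
    simp [E']
  have h1 := Finset.card_le_card hins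
  have h2 : ({s(v, a), s(v, b), s(v, c)} : Finset (Sym2 V)).card = 3 :=
    Finset.card_eq_three.2
      ⟨_, _, _, by simp [hab, hvb], by simp [hac, hvc], by simp [hbc, hvc], rfl⟩
  rw [Finset.card_union_of_disjoint hdisj, h2] at h1
  have h3 := hsp (insert v W) (by rw [Finset.card_insert_of_notMem hvW]; omega)
  rw [Finset.card_insert_of_notMem hvW] at h3
  omega

/-! ### Infinitesimal rigidity of coordinated frameworks -/

/-- The rigidity matrix of a coordinated framework. -/
noncomputable def coordMatrix (G : SimpleGraph V) (c : Sym2 V → Option (Fin k)) (p : Cfg V d) :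
    Matrix G.edgeSet ((V × Fin d) ⊕ Fin k) ℝ :=
  fun e => coordRow c p e

theorem sum_coordRow_mul (c : Sym2 V → Option (Fin k)) (p : Cfg V d) (a b : V)
    (z : V × Fin d → ℝ) (r : Fin k → ℝ) :
    coordRow c p s(a, b) ⬝ᵥ Sum.elim z r =
      ∑ i, (p b i - p a i) * (z (b, i) - z (a, i)) +
        ∑ ℓ, (if c s(a, b) = some ℓ then r ℓ else 0) := by
  rw [dotProduct, Fintype.sum_sum_type,
    ← sum_rRow_mul p z (Finset.mem_univ a) (Finset.mem_univ b), Fintype.sum_prod_type]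
  simp [coordRow]

theorem inner_sub_sub (p p' : Cfg V d) (a b : V) :
    ⟪p b - p a, p' b - p' a⟫ = ∑ i, (p b i - p a i) * (p' b i - p' a i) := by
  simp [PiLp.inner_apply, mul_comm]

theorem isCoordInfMotion_iff (G : SimpleGraph V) (c : Sym2 V → Option (Fin k)) (p p' : Cfg V d)
    (r' : Fin k → ℝ) :
    IsCoordInfMotion G c p p' r' ↔
      (Sum.elim (fun x => p' x.1 x.2) r') ∈ LinearMap.ker (coordMatrix G c p).mulVecLin := by
  rw [LinearMap.mem_ker, Matrix.mulVecLin_apply, funext_iff]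
  constructor
  · rintro ⟨h0, h1⟩ ⟨e, he⟩
    induction e using Sym2.ind with | _ a b =>
    change coordRow c p s(a, b) ⬝ᵥ _ = 0
    rw [sum_coordRow_mul, ← inner_sub_sub]
    cases hce : c s(a, b) with
    | none => simpa using h0 a b he hce
    | some ℓ => simpa using h1 a b ℓ he hce
  · intro h
    refine ⟨fun a b hab hce => ?_, fun a b ℓ hab hce => ?_⟩
    all_goals
      have h' : coordRow c p s(a, b) ⬝ᵥ _ = 0 := h ⟨s(a, b), hab⟩
      rw [sum_coordRow_mul, ← inner_sub_sub, hce] at h'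
      simpa using h'

/-- The trivial motions of a coordinated framework. -/
noncomputable def coordTrivial (k : ℕ) (p : Cfg V 2) (j : Fin 3) : (V × Fin 2) ⊕ Fin k → ℝ :=
  Sum.elim (trivialMotion p j) 0

theorem linearIndependent_coordTrivial {p : Cfg V 2} {a b : V} (hab : p a 0 ≠ p b 0) :
    LinearIndependent ℝ (coordTrivial k p) := by
  have h := linearIndependent_trivialMotion (Finset.mem_univ a) (Finset.mem_univ b) hab
  refine LinearIndependent.of_comp
    (LinearMap.funLeft ℝ ℝ fun y : {v : V // v ∈ Finset.univ} × Fin 2 => .inl (y.1.1, y.2)) ?_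
  exact h

theorem mem_span_coordTrivial_iff (p p' : Cfg V 2) (r' : Fin k → ℝ) :
    Sum.elim (fun x => p' x.1 x.2) r' ∈ Submodule.span ℝ (Set.range (coordTrivial k p)) ↔
      r' = 0 ∧ IsTrivialMotion p p' := by
  rw [Submodule.mem_span_range_iff_exists_fun]
  constructor
  · rintro ⟨m, hm⟩
    refine ⟨funext fun ℓ => ?_, !![0, -m 2; m 2, 0], ![m 0, m 1], ?_, fun v i => ?_⟩
    · simpa [Fin.sum_univ_three, coordTrivial] using (congrFun hm (.inr ℓ)).symm
    · ext i j
      fin_cases i <;> fin_cases j <;> simp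
    · have := (congrFun hm (.inl (v, i))).symm
      fin_cases i <;> simp [Fin.sum_univ_three, coordTrivial, trivialMotion] at this ⊢ <;>
        linarith
  · rintro ⟨rfl, S, t, hS, h⟩
    have h00 := congrFun (congrFun hS 0) 0
    have h11 := congrFun (congrFun hS 1) 1
    have h01 := congrFun (congrFun hS 1) 0
    simp only [Matrix.transpose_apply, Matrix.neg_apply] at h00 h11 h01
    have h00' : S 0 0 = 0 := by linarith
    have h11' : S 1 1 = 0 := by linarith
    refine ⟨![t 0, t 1, S 1 0], funext ?_⟩
    rintro (⟨v, i⟩ | ℓ)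
    · fin_cases i <;>
        simp [Fin.sum_univ_three, coordTrivial, trivialMotion, h, h00', h11', h01] <;> ring
    · simp [coordTrivial]

theorem coordInfRigid_iff (G : SimpleGraph V) (c : Sym2 V → Option (Fin k)) (p : Cfg V 2) :
    CoordInfRigid G c p ↔ LinearMap.ker (coordMatrix G c p).mulVecLin ≤
      Submodule.span ℝ (Set.range (coordTrivial k p)) := by
  constructor
  · intro h z hz
    obtain ⟨p', r', rfl⟩ : ∃ (p' : Cfg V 2) (r' : Fin k → ℝ),
        Sum.elim (fun x => p' x.1 x.2) r' = z := by
      refine ⟨fun v => WithLp.toLp 2 fun i => z (.inl (v, i)), fun ℓ => z (.inr ℓ), ?_⟩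
      ext (x | ℓ) <;> rfl
    rw [mem_span_coordTrivial_iff]
    exact h p' r' ((isCoordInfMotion_iff G c p p' r').2 hz)
  · intro h p' r' hm
    rw [← mem_span_coordTrivial_iff]
    exact h ((isCoordInfMotion_iff G c p p' r').1 hm)

theorem span_coordTrivial_le_ker (G : SimpleGraph V) (c : Sym2 V → Option (Fin k))
    (p : Cfg V 2) : Submodule.span ℝ (Set.range (coordTrivial k p)) ≤
      LinearMap.ker (coordMatrix G c p).mulVecLin := by
  rw [Submodule.span_le]
  rintro _ ⟨j, rfl⟩
  obtain ⟨p', hp'⟩ : ∃ p' : Cfg V 2, ∀ x : V × Fin 2, p' x.1 x.2 = trivialMotion p j x :=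
    ⟨fun v => WithLp.toLp 2 fun i => trivialMotion p j (v, i), fun _ => rfl⟩
  have h (a b : V) : ⟪p b - p a, p' b - p' a⟫ = 0 := by
    rw [inner_sub_sub, ← sum_rRow_mul_trivialMotion p j (Finset.mem_univ a) (Finset.mem_univ b),
      sum_rRow_mul p _ (Finset.mem_univ a) (Finset.mem_univ b)]
    simp only [← hp']
  have h' := (isCoordInfMotion_iff G c p p' 0).1
    ⟨fun a b _ _ => h a b, fun a b ℓ _ _ => by simpa using h a b⟩
  simp only [hp'] at h'
  exact h'

theorem coordInfRigid_iff_ncard {G : SimpleGraph V} {c : Sym2 V → Option (Fin k)} {p : Cfg V 2}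
    {a b : V} (hab : p a 0 ≠ p b 0)
    (h : LinearIndependent ℝ fun e : G.edgeSet => coordRow c p e) :
    CoordInfRigid G c p ↔ G.edgeSet.ncard + 3 = 2 * Fintype.card V + k := by
  have h1 := finrank_span_eq_card (linearIndependent_coordTrivial (k := k) hab)
  have : Fintype G.edgeSet := Fintype.ofFinite _
  have h2 : (coordMatrix G c p).rank = Fintype.card G.edgeSet := LinearIndependent.rank_matrix h
  have h3 := (coordMatrix G c p).mulVecLin.finrank_range_add_finrank_ker
  rw [Module.finrank_fintype_fun_eq_card, ← Matrix.rank, h2, Fintype.card_sum, Fintype.card_prod,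
    Fintype.card_fin, Fintype.card_fin, ← Nat.card_eq_fintype_card, Nat.card_coe_set_eq] at h3
  rw [Fintype.card_fin] at h1
  have h4 := span_coordTrivial_le_ker G c p
  rw [coordInfRigid_iff]
  constructor
  · intro h5
    rw [h5.antisymm h4] at h3
    omega
  · intro h5
    exact (Submodule.eq_of_le_of_finrank_eq h4 (by omega)).ge

/-! ### Ranks of coloured edge sets -/

/-- Extension by zero to the columns of the colour classes. -/
def extendZero (V : Type*) (d k : ℕ) :
    (V × Fin d → ℝ) →ₗ[ℝ] ((V × Fin d) ⊕ Fin k → ℝ) where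
  toFun z := Sum.elim z 0
  map_add' _ _ := by ext (_ | _) <;> simp
  map_smul' _ _ := by ext (_ | _) <;> simp

theorem extendZero_injective : Function.Injective (extendZero V d k) :=
  fun _ _ h => funext fun x => congrFun h (.inl x)

theorem Function.Injective.linearIndepOn_image_iff {ι ι' M : Type*} [AddCommGroup M] [Module ℝ M]
    {f : ι → ι'} (hf : f.Injective) (g : ι' → M) (s : Set ι) :
    LinearIndepOn ℝ g (f '' s) ↔ LinearIndepOn ℝ (fun i => g (f i)) s :=
  ⟨fun h => h.comp_of_image hf.injOn, fun h => h.image_of_comp f g⟩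

theorem linearIndepOn_rRow_iff (k : ℕ) (p : Cfg V d) (F : Set (Sym2 V)) :
    LinearIndepOn ℝ (rRow p) F ↔
      LinearIndepOn ℝ (wRow p) ((fun e => (e, (0 : Fin k → ℚ))) '' F) := by
  rw [Function.Injective.linearIndepOn_image_iff fun _ _ h => congrArg Prod.fst h,
    ← (extendZero V d k).linearIndepOn_iff_of_injOn extendZero_injective.injOn]
  refine iff_of_eq (congrArg (LinearIndepOn ℝ · F) (funext fun e => ?_))
  ext (_ | _) <;> simp [extendZero]

theorem Generic.linearIndepOn_rRow {p p₀ : Cfg V d} (hp₀ : Generic p₀) {F : Set (Sym2 V)}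
    (h : LinearIndepOn ℝ (rRow p) F) : LinearIndepOn ℝ (rRow p₀) F := by
  rw [linearIndepOn_rRow_iff 0] at h ⊢
  exact hp₀.linearIndepOn_wRow (Set.toFinite F |>.image _) h

theorem exists_subset_card_eq_spanRank {α M : Type*} [AddCommGroup M] [Module ℝ M]
    [FiniteDimensional ℝ M] (f : α → M) (E : Finset α) :
    ∃ B ⊆ E, LinearIndepOn ℝ f (B : Set α) ∧ B.card = spanRank f (E : Set α) := by
  obtain ⟨B, hBE, -, hspan, hli⟩ := exists_linearIndepOn_extension
    (linearIndepOn_empty ℝ f) (Set.empty_subset (E : Set α))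
  lift B to Finset α using E.finite_toSet.subset hBE
  refine ⟨B, Finset.coe_subset.1 hBE, hli, ?_⟩
  rw [← spanRank_eq_card_of_linearIndepOn f hli]
  exact (spanRank_mono f hBE).antisymm (Submodule.finrank_mono (Submodule.span_le.2 hspan))

theorem Generic.spanRank_rRow_le {p p₀ : Cfg V d} (hp₀ : Generic p₀) (E : Finset (Sym2 V)) :
    spanRank (rRow p) (E : Set (Sym2 V)) ≤ spanRank (rRow p₀) (E : Set (Sym2 V)) := by
  obtain ⟨B, hBE, hli, hcard⟩ := exists_subset_card_eq_spanRank (rRow p) E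
  rw [← hcard, ← spanRank_eq_card_of_linearIndepOn _ (hp₀.linearIndepOn_rRow hli)]
  exact spanRank_mono _ (Finset.coe_subset.2 hBE)

theorem card_add_spanRank_le {α M : Type*} [AddCommGroup M] [Module ℝ M]
    [FiniteDimensional ℝ M] [DecidableEq α] (f : α → M) {F E : Finset α} (h : F ⊆ E) :
    F.card + spanRank f (E : Set α) ≤ E.card + spanRank f (F : Set α) := by
  have h1 := spanRank_union_add_inter f (F : Set α) (E \ F : Finset α)
  have h2 := spanRank_le_card f (E \ F)
  rw [← Finset.coe_union, Finset.union_sdiff_of_subset h] at h1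
  have h3 := Finset.card_sdiff_add_card_eq_card h
  omega

theorem Generic.spanRank_rRow_inter_sym2_le {p : Cfg V 2} (hp : Generic p)
    (E : Finset (Sym2 V)) {X : Finset V} (hX : 2 ≤ X.card) :
    spanRank (rRow p) (E ∩ X.sym2 : Finset (Sym2 V)) ≤ 2 * X.card - 3 := by
  obtain ⟨a, ha, b, hb, hab⟩ := Finset.one_lt_card.1 hX
  refine _root_.CoordRigidity.spanRank_rRow_le ha hb (_root_.sub_ne_zero.1 (hp.sub_ne_zero hab)) ?_
  intro e he _
  exact Finset.mem_sym2_iff.1 (Finset.mem_inter.1 he).2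

theorem Generic.isSparse {p : Cfg V 2} (hp : Generic p) {E : Finset (Sym2 V)}
    (h : LinearIndepOn ℝ (rRow p) (E : Set (Sym2 V))) : IsSparse E := by
  intro X hX
  rw [← spanRank_eq_card_of_linearIndepOn (rRow p)
    (h.mono (Finset.coe_subset.2 Finset.inter_subset_left))]
  exact hp.spanRank_rRow_inter_sym2_le E hX

theorem IsSparse.linearIndepOn_rRow {p : Cfg V 2} (hp : Generic p) {E : Finset (Sym2 V)}
    (hE : ∀ e ∈ E, ¬ e.IsDiag) (h : IsSparse E) :
    LinearIndepOn ℝ (rRow p) (E : Set (Sym2 V)) := by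
  rw [linearIndepOn_rRow_iff 2]
  have := IsSparse.linearIndepOn_wRow hp Finset.univ E hE (by simp) h
  rwa [unweighted, Finset.coe_image] at this

/-- An edge together with the characteristic vector of its colour class. -/
def tagged (c : Sym2 V → Option (Fin k)) (e : Sym2 V) : Sym2 V × (Fin k → ℚ) :=
  (e, fun ℓ => if c e = some ℓ then 1 else 0)

theorem tagged_injective (c : Sym2 V → Option (Fin k)) : (tagged c).Injective :=
  fun _ _ h => congrArg Prod.fst h

theorem wRow_tagged (c : Sym2 V → Option (Fin k)) (p : Cfg V d) (e : Sym2 V) :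
    wRow p (tagged c e) = coordRow c p e := by
  ext (_ | ℓ)
  · rfl
  · simp [tagged, coordRow, apply_ite (Rat.cast : ℚ → ℝ)]

theorem card_le_spanRank_weight {c : Sym2 V → Option (Fin k)} {F : Set (Sym2 V)}
    {K : Finset (Fin k)} (hK : ∀ ℓ ∈ K, ∃ e ∈ F, c e = some ℓ) :
    K.card ≤ spanRank weight (tagged c '' F) := by
  have h : LinearIndepOn ℝ (Pi.basisFun ℝ (Fin k)) (K : Set (Fin k)) :=
    (Pi.basisFun ℝ (Fin k)).linearIndependent.linearIndepOn _
  rw [← spanRank_eq_card_of_linearIndepOn _ h]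
  refine Submodule.finrank_mono (Submodule.span_mono ?_)
  rintro _ ⟨ℓ, hℓ, rfl⟩
  obtain ⟨e, he, hce⟩ := hK ℓ hℓ
  refine ⟨_, ⟨e, he, rfl⟩, ?_⟩
  ext m
  simp [weight, tagged, hce, Pi.single_apply, eq_comm, apply_ite (Rat.cast : ℚ → ℝ)]

theorem card_le_of_linearIndepOn_coordRow {c : Sym2 V → Option (Fin k)} {p : Cfg V d}
    {F : Finset (Sym2 V)} (h : LinearIndepOn ℝ (coordRow c p) (F : Set (Sym2 V)))
    (K : Finset (Fin k)) (hK : ∀ e ∈ F, ∀ ℓ, c e = some ℓ → ℓ ∈ K) :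
    F.card ≤ spanRank (rRow p) (F : Set (Sym2 V)) + K.card := by
  let u : Fin k → (V × Fin d) ⊕ Fin k → ℝ := fun ℓ => Pi.single (.inr ℓ) 1
  have hle : Submodule.span ℝ (coordRow c p '' F) ≤
      (Submodule.span ℝ (rRow p '' F)).map (extendZero V d k) ⊔ Submodule.span ℝ (u '' K) := by
    rw [Submodule.span_le]
    rintro _ ⟨e, he, rfl⟩
    have h1 : extendZero V d k (rRow p e) ∈
        (Submodule.span ℝ (rRow p '' F)).map (extendZero V d k) :=
      Submodule.mem_map_of_mem (Submodule.subset_span ⟨e, he, rfl⟩)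
    cases hce : c e with
    | none =>
      refine Submodule.mem_sup_left ?_
      convert h1 using 1
      ext (_ | _) <;> simp [coordRow, extendZero, hce]
    | some ℓ =>
      have h2 : u ℓ ∈ Submodule.span ℝ (u '' K) :=
        Submodule.subset_span ⟨ℓ, hK e he ℓ hce, rfl⟩
      have h3 : coordRow c p e = extendZero V d k (rRow p e) + u ℓ := by
        ext (_ | m)
        · simp [coordRow, extendZero, u]
        · simp [coordRow, extendZero, u, hce, Pi.single_apply, eq_comm]
      exact h3 ▸ Submodule.add_mem_sup h1 h2
  have h1 := Submodule.finrank_mono hle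
  have h2 := Submodule.finrank_add_le_finrank_add_finrank
    ((Submodule.span ℝ (rRow p '' F)).map (extendZero V d k)) (Submodule.span ℝ (u '' K))
  have h3 := Submodule.finrank_map_le (extendZero V d k) (Submodule.span ℝ (rRow p '' F))
  have h4 := spanRank_le_card u K
  have h5 := spanRank_eq_card_of_linearIndepOn _ h
  rw [spanRank] at h4 h5 ⊢
  omega

theorem linearIndepOn_coordRow {p : Cfg V 2} (hp : Generic p) {E : Finset (Sym2 V)}
    (hE : ∀ e ∈ E, ¬ e.IsDiag) {c : Sym2 V → Option (Fin 2)}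
    (h0 : IsSparse (E.filter (c · = none)))
    (h1 : ∀ i, ∃ e ∈ E, c e = some i ∧
      spanRank (rRow p) (E.erase e : Finset (Sym2 V)) = spanRank (rRow p) (E : Set (Sym2 V)))
    (hcard : E.card ≤ spanRank (rRow p) (E : Set (Sym2 V)) + 2) :
    LinearIndepOn ℝ (coordRow c p) (E : Set (Sym2 V)) := by
  have hrow : coordRow c p = fun e => wRow p (tagged c e) :=
    funext fun e => (wRow_tagged c p e).symm
  rw [hrow, ← Function.Injective.linearIndepOn_image_iff (tagged_injective c), ← Finset.coe_image]
  refine Rado.linearIndepOn_wRow hp Finset.univ _ ?_ (fun _ _ _ _ _ => Finset.mem_univ _) ?_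
  · intro t ht t' ht' _ htt'
    obtain ⟨e, -, rfl⟩ := Finset.mem_image.1 ht
    obtain ⟨e', -, rfl⟩ := Finset.mem_image.1 ht'
    exact congrArg (tagged c) htt'
  · intro F hF
    obtain ⟨F, hFE, rfl⟩ := Finset.subset_image_iff.1 hF
    rw [Finset.card_image_of_injective _ (tagged_injective c), spanRank_eRow, Finset.coe_image,
      Set.image_image]
    change F.card ≤ spanRank (rRow p) ((fun e => e) '' (F : Set (Sym2 V))) + _
    rw [Set.image_id']
    have hK := card_le_spanRank_weight (c := c) (F := (F : Set (Sym2 V)))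
      (K := Finset.univ.filter fun ℓ => ∃ e ∈ F, c e = some ℓ) (by simp)
    by_cases hall : ∀ ℓ, ∃ e ∈ F, c e = some ℓ
    · rw [Finset.filter_true_of_mem fun ℓ _ => hall ℓ, Finset.card_fin] at hK
      have := card_add_spanRank_le (rRow p) hFE
      omega
    · push Not at hall
      obtain ⟨i, hi⟩ := hall
      obtain ⟨e, he, hce, hrank⟩ := h1 i
      have h2 : F ⊆ E.erase e := fun f hf =>
        Finset.mem_erase.2 ⟨fun hfe => hi f hf (hfe ▸ hce), hFE hf⟩
      have h3 := card_add_spanRank_le (rRow p) h2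
      have h4 := Finset.card_erase_add_one he
      obtain hempty | ⟨ℓ, hℓ⟩ :=
        (Finset.univ.filter fun ℓ => ∃ e ∈ F, c e = some ℓ).eq_empty_or_nonempty
      · have h5 : F ⊆ E.filter (c · = none) := by
          intro f hf
          refine Finset.mem_filter.2 ⟨hFE hf, Option.eq_none_iff_forall_ne_some.2 fun ℓ hℓ => ?_⟩
          exact Finset.notMem_empty ℓ
            (hempty ▸ Finset.mem_filter.2 ⟨Finset.mem_univ ℓ, f, hf, hℓ⟩)
        have h6 := (h0.mono h5).linearIndepOn_rRow hp fun f hf => hE f (hFE hf)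
        have h7 := spanRank_eq_card_of_linearIndepOn _ h6
        omega
      · have := Finset.card_pos.2 ⟨ℓ, hℓ⟩
        omega

/-! ### Counting conditions -/

theorem ncard_edgesWithin (E : Finset (Sym2 V)) (X : Finset V) :
    (edgesWithin (E : Set (Sym2 V)) (X : Set V)).ncard = (E ∩ X.sym2).card := by
  rw [← Set.ncard_coe_finset]
  congr 1
  ext e
  rw [Finset.mem_coe, Finset.mem_inter, Finset.mem_sym2_iff]
  rfl

theorem lamanSparseOn_univ_iff (E : Finset (Sym2 V)) :
    LamanSparseOn Set.univ (E : Set (Sym2 V)) ↔ IsSparse E := by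
  refine ⟨fun h X hX => ?_, fun h W _ hW => ?_⟩
  · simpa only [ncard_edgesWithin, Set.ncard_coe_finset] using
      h X (Set.subset_univ _) (by rwa [Set.ncard_coe_finset])
  · lift W to Finset V using W.toFinite
    rw [ncard_edgesWithin]
    rw [Set.ncard_coe_finset] at hW ⊢
    exact h W hW

theorem Generic.redundantSet_singleton_iff {p : Cfg V 2} (hp : Generic p) {G : SimpleGraph V}
    {E : Finset (Sym2 V)} (hE : (E : Set (Sym2 V)) = G.edgeSet) (e : Sym2 V) :
    RedundantSet 2 G {e} ↔
      spanRank (rRow p) (E.erase e : Finset (Sym2 V)) = spanRank (rRow p) (E : Set (Sym2 V)) := by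
  rw [RedundantSet, ← hE, ← Finset.coe_singleton, ← Finset.coe_sdiff,
    Finset.sdiff_singleton_eq_erase]
  refine ⟨fun h => h p hp, fun h q hq => ?_⟩
  have h1 := (hp.spanRank_rRow_le (p := q) (E.erase e)).antisymm (hq.spanRank_rRow_le _)
  have h2 := (hp.spanRank_rRow_le (p := q) E).antisymm (hq.spanRank_rRow_le _)
  exact h1.trans (h.trans h2.symm)

theorem spanRank_sdiff_add_card_le {α M : Type*} [AddCommGroup M] [Module ℝ M]
    [FiniteDimensional ℝ M] [DecidableEq α] (f : α → M) {E D : Finset α} (hD : D ⊆ E)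
    (h : ∀ e ∈ D, spanRank f (E.erase e : Finset α) ≠ spanRank f (E : Set α)) :
    spanRank f (E \ D : Finset α) + D.card ≤ spanRank f (E : Set α) := by
  induction D using Finset.induction_on with
  | empty => simp
  | insert e D heD ih =>
    have heE : e ∈ E := hD (Finset.mem_insert_self e D)
    have h1 := ih ((Finset.subset_insert e D).trans hD) fun x hx =>
      h x (Finset.mem_insert_of_mem hx)
    have h2 := (spanRank_mono f (Finset.coe_subset.2 (Finset.erase_subset e E))).lt_of_ne
      (h e (Finset.mem_insert_self e D))
    have h3 := spanRank_union_add_inter f (E \ D : Finset α) (E.erase e : Finset α)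
    have h4 : (E \ D) ∪ E.erase e = E := by grind
    have h5 : (E \ D) ∩ E.erase e = E \ insert e D := by grind
    rw [← Finset.coe_union, ← Finset.coe_inter, h4, h5] at h3
    rw [Finset.card_insert_of_notMem heD]
    omega

/-- **Laman-type theorem for two coordination classes.** A `2`-coloured graph `(G,c)` is
generically isostatic in the plane iff (1) `G` is a Laman+2 graph, (2) no colour class
consists only of bridges of the generic rigidity matroid `M_2(G)`, and (3) `G_0` is
Laman-sparse and both `G_1` and `G_2` are `(2,2)`-sparse. -/
theorem two_class_isostatic_iff {V : Type*} [Fintype V] [DecidableEq V]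
    (G : SimpleGraph V) (c : Sym2 V → Option (Fin 2))
    (hc : ∀ i : Fin 2, ∃ e ∈ G.edgeSet, c e = some i) :
    GenericallyIsostaticCoord 2 G c ↔
      (IsLamanPlusTwo G ∧
        (∀ i : Fin 2, ¬ ∀ e ∈ {e ∈ G.edgeSet | c e = some i}, ¬ RedundantSet 2 G {e}) ∧
        LamanSparseOn Set.univ {e ∈ G.edgeSet | c e = none} ∧
        ∀ i : Fin 2, Sparse22On Set.univ {e ∈ G.edgeSet | c e = none ∨ c e = some i}) := by
  obtain ⟨E, hE⟩ := G.edgeSet.toFinite.exists_finset_coe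
  have hdiag : ∀ e ∈ E, ¬ e.IsDiag := fun e he =>
    G.not_isDiag_of_mem_edgeSet (hE ▸ Finset.mem_coe.2 he)
  have hfilter (P : Sym2 V → Prop) [DecidablePred P] :
      {e ∈ G.edgeSet | P e} = (E.filter P : Set (Sym2 V)) := by
    rw [Finset.coe_filter, ← hE]
    rfl
  have hdiff (e f : Sym2 V) : G.edgeSet \ {e, f} = (E \ {e, f} : Finset (Sym2 V)) := by
    rw [← hE]
    simp
  obtain ⟨a, b, hab⟩ : ∃ a b : V, a ≠ b := by
    obtain ⟨e, he, -⟩ := hc 0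
    induction e using Sym2.ind with | _ a b => exact ⟨a, b, G.ne_of_adj he⟩
  have hV : 2 ≤ Fintype.card V := Fintype.one_lt_card_iff.2 ⟨a, b, hab⟩
  have hcardE : G.edgeSet.ncard = E.card := by rw [← hE, Set.ncard_coe_finset]
  have hrank {p : Cfg V 2} (hp : Generic p) :
      spanRank (rRow p) (E : Set (Sym2 V)) ≤ 2 * Fintype.card V - 3 := by
    have := hp.spanRank_rRow_inter_sym2_le E (X := Finset.univ) hV
    rwa [Finset.inter_eq_left.2 fun e _ => by simp] at this
  constructor
  · intro h
    obtain ⟨p, hp⟩ := exists_generic V 2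
    obtain ⟨hli, hrig⟩ := h p hp
    have hcard := (coordInfRigid_iff_ncard (sub_ne_zero.1 (hp.sub_ne_zero hab)) hli).1 hrig
    have hli' : LinearIndepOn ℝ (coordRow c p) (E : Set (Sym2 V)) := hE ▸ hli
    have hle : ∀ F ⊆ E, ∀ K : Finset (Fin 2), (∀ e ∈ F, ∀ ℓ, c e = some ℓ → ℓ ∈ K) →
        F.card ≤ spanRank (rRow p) (F : Set (Sym2 V)) + K.card := fun F hF =>
      card_le_of_linearIndepOn_coordRow (hli'.mono (Finset.coe_subset.2 hF))
    have hrankE : spanRank (rRow p) (E : Set (Sym2 V)) = 2 * Fintype.card V - 3 := by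
      have h1 := hrank hp
      have h2 := hle E subset_rfl Finset.univ (by simp)
      rw [Finset.card_fin] at h2
      omega
    refine ⟨⟨by omega, ?_⟩, fun i hi => ?_, ?_, fun i => ?_⟩
    · obtain ⟨B, hBE, hB, hBcard⟩ := exists_subset_card_eq_spanRank (rRow p) E
      have h1 := Finset.card_sdiff_add_card_eq_card hBE
      obtain ⟨e, f, hef, hsdiff⟩ := Finset.card_eq_two.1 (show (E \ B).card = 2 by omega)
      have he : e ∈ E \ B := by simp [hsdiff]
      have hf : f ∈ E \ B := by simp [hsdiff]
      refine ⟨e, hE ▸ (Finset.mem_sdiff.1 he).1, f, hE ▸ (Finset.mem_sdiff.1 hf).1, hef, ?_⟩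
      rw [hdiff, ← hsdiff, Finset.sdiff_sdiff_eq_self hBE]
      refine ⟨(lamanSparseOn_univ_iff B).2 (hp.isSparse hB), ?_⟩
      rw [Set.ncard_coe_finset, Set.ncard_univ, Nat.card_eq_fintype_card]
      omega
    · have h1 := spanRank_sdiff_add_card_le (rRow p) (Finset.filter_subset (c · = some i) E)
        fun e he hr => hi e (by rw [hfilter]; exact he)
          ((hp.redundantSet_singleton_iff hE e).2 hr)
      have h2 := hle (E \ E.filter (c · = some i)) Finset.sdiff_subset (Finset.univ.erase i)
        (by grind)
      have h3 := Finset.card_sdiff_add_card_eq_card (Finset.filter_subset (c · = some i) E)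
      rw [Finset.card_erase_of_mem (Finset.mem_univ i), Finset.card_fin] at h2
      omega
    · rw [hfilter, lamanSparseOn_univ_iff]
      intro X hX
      have h1 := hle (E.filter (c · = none) ∩ X.sym2)
        (Finset.inter_subset_left.trans (Finset.filter_subset _ _)) ∅ (by grind)
      exact h1.trans (hp.spanRank_rRow_inter_sym2_le _ hX)
    · rw [hfilter]
      intro W _ hW
      lift W to Finset V using W.toFinite
      rw [ncard_edgesWithin]
      rw [Set.ncard_coe_finset] at hW ⊢
      have h1 := hle (E.filter (fun e => c e = none ∨ c e = some i) ∩ W.sym2)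
        (Finset.inter_subset_left.trans (Finset.filter_subset _ _)) {i} (by grind)
      have h2 := hp.spanRank_rRow_inter_sym2_le (E.filter fun e => c e = none ∨ c e = some i) hW
      rw [Finset.card_singleton] at h1
      omega
  · rintro ⟨⟨hcard, e, -, f, -, -, hsparse, hcard'⟩, hred, hsparse₀, -⟩ p hp
    rw [hdiff] at hsparse hcard'
    rw [Set.ncard_coe_finset, Set.ncard_univ, Nat.card_eq_fintype_card] at hcard'
    rw [hfilter, lamanSparseOn_univ_iff] at hsparse₀
    have h1 := ((lamanSparseOn_univ_iff _).1 hsparse).linearIndepOn_rRow hp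
      fun x hx => hdiag x (Finset.mem_sdiff.1 hx).1
    have h2 := spanRank_eq_card_of_linearIndepOn _ h1
    have h3 := spanRank_mono (rRow p)
      (Finset.coe_subset.2 (Finset.sdiff_subset (s := E) (t := {e, f})))
    have hli : LinearIndepOn ℝ (coordRow c p) G.edgeSet := by
      rw [← hE]
      refine linearIndepOn_coordRow hp hdiag hsparse₀ (fun i => ?_) (by omega)
      have h4 := hred i
      push Not at h4
      obtain ⟨x, hx, hxr⟩ := h4
      rw [hfilter] at hx
      exact ⟨x, (Finset.mem_filter.1 hx).1, (Finset.mem_filter.1 hx).2,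
        (hp.redundantSet_singleton_iff hE x).1 hxr⟩
    refine ⟨hli, (coordInfRigid_iff_ncard (sub_ne_zero.1 (hp.sub_ne_zero hab)) hli).2 ?_⟩
    omega

end CoordRigidity
end

section
/- Fix a dimension d and a finite simple graph G = (V,E). If p and q are two generic configurations of V in ℝ^d, then the linear matroids induced on E by the rows of the rigidity matrices R(p) and R(q) coincide; that is, a set F ⊆ E indexes a linearly independent set of rows of R(p) if and only if it indexes a linearly independent set of rows of R(q). -/
open scoped RealInnerProductSpace

namespace CoordRigidity

variable {V : Type*} [Fintype V] [DecidableEq V] {d k : ℕ}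

/-- Over `ℝ`, the rows of `M` are linearly independent iff their Gram determinant is nonzero. -/
theorem linearIndependent_row_iff_det_mul_transpose_ne_zero {m n : Type*} [Fintype m]
    [DecidableEq m] [Fintype n] (M : Matrix m n ℝ) :
    LinearIndependent ℝ M.row ↔ (M * M.transpose).det ≠ 0 := by
  rw [Ne, ← Matrix.exists_vecMul_eq_zero_iff, ← Matrix.conjTranspose_eq_transpose_of_trivial,
    ← Matrix.vecMul_injective_iff, ← Matrix.coe_vecMulLinear, injective_iff_map_eq_zero]
  simp only [Matrix.vecMul_self_mul_conjTranspose_eq_zero, Matrix.vecMulLinear_apply]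
  grind

/-- The row of the rigidity matrix of an edge at the configuration of indeterminates. -/
noncomputable def polyRow (V : Type*) [DecidableEq V] (d : ℕ) :
    Sym2 V → (V × Fin d → MvPolynomial (V × Fin d) ℚ) :=
  Sym2.lift ⟨fun i j vk =>
      (if vk.1 = i then MvPolynomial.X (i, vk.2) - MvPolynomial.X (j, vk.2) else 0) +
      (if vk.1 = j then MvPolynomial.X (j, vk.2) - MvPolynomial.X (i, vk.2) else 0),
    fun _ _ => funext fun _ => add_comm _ _⟩

theorem aeval_polyRow {W : Type*} [DecidableEq W] (p : Cfg W d) (e : Sym2 W)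
    (vk : W × Fin d) :
    MvPolynomial.aeval (fun vi : W × Fin d => p vi.1 vi.2) (polyRow W d e vk) = rRow p e vk := by
  induction e using Sym2.ind with
  | _ i j =>
    simp only [polyRow, rRow, Sym2.lift_mk, map_add]
    split_ifs <;> simp

/-- At a generic configuration, independence of rows is decided by a polynomial Gram
determinant that does not depend on the configuration. -/
theorem Generic.linearIndependent_rRow_iff {p : Cfg V d} (hp : Generic p) (F : Set (Sym2 V))
    [Fintype F] :
    LinearIndependent ℝ (fun e : F => rRow p ↑e) ↔
      ((Matrix.of fun e : F => polyRow V d ↑e) *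
        (Matrix.of fun e : F => polyRow V d ↑e).transpose).det ≠ 0 := by
  have hM : (Matrix.of fun e : F => rRow p ↑e) = (Matrix.of fun e : F => polyRow V d ↑e).map
      (MvPolynomial.aeval (R := ℚ) (fun vi : V × Fin d => p vi.1 vi.2)) := by
    ext e vk
    exact (aeval_polyRow p _ _).symm
  change LinearIndependent ℝ (Matrix.of fun e : F => rRow p ↑e).row ↔ _
  rw [linearIndependent_row_iff_det_mul_transpose_ne_zero, hM, ← Matrix.transpose_map,
    ← Matrix.map_mul, ← AlgHom.mapMatrix_apply, ← AlgHom.map_det]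
  exact map_ne_zero_iff _ hp

/-- For any two generic configurations `p` and `q`, the linear matroids induced on the
edge set of `G` by the rows of the rigidity matrices `R(p)` and `R(q)` coincide. -/
theorem generic_rigidity_matroid_well_defined {V : Type*} [Fintype V] [DecidableEq V]
    {d : ℕ} (G : SimpleGraph V) (p q : Cfg V d) (hp : Generic p) (hq : Generic q)
    (F : Set (Sym2 V)) (hF : F ⊆ G.edgeSet) :
    LinearIndependent ℝ (fun e : F => rRow p ↑e) ↔
      LinearIndependent ℝ (fun e : F => rRow q ↑e) := by
  have := Fintype.ofFinite F
  rw [hp.linearIndependent_rRow_iff, hq.linearIndependent_rRow_iff]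

end CoordRigidity
end
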